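/- Let F be a finite field of odd order q and characteristic p, and let π be a set of primes with 2 ∈ π, 3 ∈ π, and p ∉ π. If SL_2(F) possesses a π-Hall subgroup, then the number of conjugacy classes of π-Hall subgroups of SL_2(F) belongs to {1, 2, 3}. -/

import Mathlib

/-- `n` is a `π`-number: every prime dividing `n` lies in `π`. -/
def IsPiNumber (π : Set ℕ) (n : ℕ) : Prop :=
  ∀ p : ℕ, p.Prime → p ∣ n → p ∈ π

/-- `H` is a `π`-Hall subgroup of `G`: its order is a `π`-number and no prime
in `π` divides its index. -/
def IsHallPi (π : Set ℕ) {G : Type*} [Group G] (H : Subgroup G) : Prop :=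
  IsPiNumber π (Nat.card H) ∧ ∀ p ∈ π, p.Prime → ¬ p ∣ H.index

/-- The conjugate `g K g⁻¹` of a subgroup `K`. -/
def conjSub {G : Type*} [Group G] (g : G) (K : Subgroup G) : Subgroup G :=
  K.map (MulAut.conj g).toMonoidHom

/-- `k_π(G)`: the number of conjugacy classes of `π`-Hall subgroups of `G`. -/
noncomputable def kPi (π : Set ℕ) (G : Type*) [Group G] : ℕ :=
  Nat.card {O : Set (Subgroup G) //
    ∃ H : Subgroup G, IsHallPi π H ∧ O = {K | ∃ g : G, conjSub g H = K}}

set_option linter.unusedSectionVars false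
namespace HallSL
open Matrix

section field
variable {K : Type*} [Field K]

abbrev M2 (K : Type*) := Matrix (Fin 2) (Fin 2) K

lemma ext2 {A B : M2 K} (h00 : A 0 0 = B 0 0) (h01 : A 0 1 = B 0 1) (h10 : A 1 0 = B 1 0)
    (h11 : A 1 1 = B 1 1) : A = B := by
  ext i j
  fin_cases i <;> fin_cases j <;> assumption

/-- anything commuting with a nonscalar matrix is a polynomial in it -/
lemma comm_span {M N : M2 K} (hM : ∀ c : K, M ≠ c • 1) (h : M * N = N * M) :
    ∃ α β : K, N = α • 1 + β • M := by
  have h00 := congrFun (congrFun h 0) 0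
  have h01 := congrFun (congrFun h 0) 1
  have h10 := congrFun (congrFun h 1) 0
  have h11 := congrFun (congrFun h 1) 1
  simp only [Matrix.mul_apply, Fin.sum_univ_two] at h00 h01 h10 h11
  by_cases hb : M 0 1 = 0
  · by_cases hc : M 1 0 = 0
    · have had : M 0 0 - M 1 1 ≠ 0 := by
        intro hd
        apply hM (M 0 0)
        apply ext2 <;> simp [hb, hc]
        linear_combination -hd
      refine ⟨N 0 0 - (N 0 0 - N 1 1) / (M 0 0 - M 1 1) * M 0 0, (N 0 0 - N 1 1) / (M 0 0 - M 1 1), ?_⟩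
      have e1 : N 0 1 = 0 := by
        have : (M 0 0 - M 1 1) * N 0 1 = 0 := by linear_combination h01 + (N 0 0 - N 1 1) * hb
        simpa [had] using this
      have e2 : N 1 0 = 0 := by
        have : (M 0 0 - M 1 1) * N 1 0 = 0 := by linear_combination -h10 + (N 0 0 - N 1 1) * hc
        simpa [had] using this
      apply ext2 <;> simp [hb, hc, e1, e2]
      field_simp
      ring
    · refine ⟨N 0 0 - N 1 0 / M 1 0 * M 0 0, N 1 0 / M 1 0, ?_⟩
      apply ext2 <;> simp
      · field_simp; linear_combination -h00
      · field_simp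
      · field_simp; linear_combination -h10
  · refine ⟨N 0 0 - N 0 1 / M 0 1 * M 0 0, N 0 1 / M 0 1, ?_⟩
    apply ext2 <;> simp
    · field_simp
    · field_simp; linear_combination h00
    · field_simp; linear_combination h01

lemma comm_trans {M A B : M2 K} (hM : ∀ c : K, M ≠ c • 1) (hA : M * A = A * M)
    (hB : M * B = B * M) : A * B = B * A := by
  obtain ⟨a, b, rfl⟩ := comm_span hM hA
  obtain ⟨c, d, rfl⟩ := comm_span hM hB
  simp only [mul_add, add_mul, smul_mul_assoc, mul_smul_comm, one_mul, mul_one]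
  simp only [smul_add, smul_smul, mul_comm c, mul_comm d]
  abel

lemma det_lin (M : M2 K) (hM : M.det = 1) (a b : K) :
    (a • (1 : M2 K) + b • M).det = a ^ 2 + a * b * M.trace + b ^ 2 := by
  rw [Matrix.det_fin_two] at hM ⊢
  simp [Matrix.trace_fin_two]
  linear_combination b ^ 2 * hM

lemma tr_lin (M : M2 K) (a b : K) :
    (a • (1 : M2 K) + b • M).trace = 2 * a + b * M.trace := by
  simp [Matrix.trace_fin_two]
  ring

lemma cayley (M : M2 K) : M * M = M.trace • M - M.det • (1 : M2 K) := by
  apply ext2 <;> simp [Matrix.mul_apply, Fin.sum_univ_two, Matrix.trace_fin_two, Matrix.det_fin_two] <;> ring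

/-- scalar in `SL₂` -/
lemma scalar_SL {x : Matrix.SpecialLinearGroup (Fin 2) K} {c : K} (h : (x : M2 K) = c • 1) :
    x = 1 ∨ x = -1 := by
  have hd := x.2
  rw [h] at hd
  simp at hd
  rcases hd with rfl | rfl
  · left; ext1; simp [h]
  · right; ext1; simp [h]

lemma nonscalar_SL {x : Matrix.SpecialLinearGroup (Fin 2) K} (h1 : x ≠ 1) (h2 : x ≠ -1) (c : K) :
    (x : M2 K) ≠ c • 1 := fun h => (scalar_SL h).elim h1 h2

lemma SL_comm_trans {x a b : Matrix.SpecialLinearGroup (Fin 2) K} (h1 : x ≠ 1) (h2 : x ≠ -1)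
    (ha : x * a = a * x) (hb : x * b = b * x) : a * b = b * a := by
  have := comm_trans (nonscalar_SL h1 h2) (A := (a : M2 K)) (B := (b : M2 K))
    (by simpa using congrArg Subtype.val ha) (by simpa using congrArg Subtype.val hb)
  apply Subtype.ext
  simpa using this

lemma SL_inv_val (x : Matrix.SpecialLinearGroup (Fin 2) K) :
    ((x⁻¹ : Matrix.SpecialLinearGroup (Fin 2) K) : M2 K) = (x : M2 K).trace • 1 - (x : M2 K) := by
  rw [Matrix.SpecialLinearGroup.coe_inv, Matrix.adjugate_fin_two]
  apply ext2 <;> simp [Matrix.trace_fin_two]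

lemma SL_sq_one (h2 : (2 : K) ≠ 0) {x : Matrix.SpecialLinearGroup (Fin 2) K} (h : x * x = 1) :
    x = 1 ∨ x = -1 := by
  have h' : x = x⁻¹ := eq_inv_of_mul_eq_one_left h
  have := congrArg Subtype.val h'
  rw [SL_inv_val] at this
  apply scalar_SL (c := (2 : K)⁻¹ * (x : M2 K).trace)
  rw [mul_smul, eq_inv_smul_iff₀ h2, two_smul]
  nth_rewrite 1 [this]
  abel

/-- `y` inverting `x` inverts the whole centralizer. -/
lemma SL_invert {x y s : Matrix.SpecialLinearGroup (Fin 2) K} (h1 : x ≠ 1) (h2 : x ≠ -1)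
    (hy : y * x * y⁻¹ = x⁻¹) (hs : x * s = s * x) : y * s * y⁻¹ = s⁻¹ := by
  obtain ⟨a, b, e⟩ := comm_span (nonscalar_SL h1 h2) (N := (s : M2 K))
    (by simpa using congrArg Subtype.val hs)
  have hy' := congrArg Subtype.val hy
  rw [SL_inv_val, Matrix.SpecialLinearGroup.coe_mul, Matrix.SpecialLinearGroup.coe_mul] at hy'
  have hyy : (y : M2 K) * ((y⁻¹ : Matrix.SpecialLinearGroup (Fin 2) K) : M2 K) = 1 := by
    rw [← Matrix.SpecialLinearGroup.coe_mul, mul_inv_cancel]; rfl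
  apply Subtype.ext
  rw [SL_inv_val, Matrix.SpecialLinearGroup.coe_mul, Matrix.SpecialLinearGroup.coe_mul, e, tr_lin]
  rw [mul_add, add_mul, mul_smul_comm, mul_smul_comm, smul_mul_assoc, smul_mul_assoc, mul_one,
    hyy, hy', smul_sub, smul_smul, add_smul, two_mul, add_smul]
  abel

/-- two commuting elements of the same trace -/
lemma SL_same_trace (h20 : (2 : K) ≠ 0) {x z : Matrix.SpecialLinearGroup (Fin 2) K} (h1 : x ≠ 1) (h2 : x ≠ -1)
    (ht : (x : M2 K).trace ^ 2 ≠ 4) (hs : x * z = z * x)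
    (htr : (z : M2 K).trace = (x : M2 K).trace) : z = x ∨ z = x⁻¹ := by
  obtain ⟨a, b, e⟩ := comm_span (nonscalar_SL h1 h2) (N := (z : M2 K))
    (by simpa using congrArg Subtype.val hs)
  have hd := z.2
  rw [e, det_lin _ x.2] at hd
  rw [e, tr_lin] at htr
  generalize ht' : (x : M2 K).trace = t at *
  have key : (b - 1) * (b + 1) = 0 := by
    have : (t ^ 2 - 4) * ((b - 1) * (b + 1)) = 0 := by
      linear_combination (-4) * hd + (2 * a + b * t + t) * htr
    exact (mul_eq_zero.1 this).resolve_left (sub_ne_zero.2 ht)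
  rcases mul_eq_zero.1 key with hb | hb
  · left
    have hb : b = 1 := by linear_combination hb
    have ha : a = 0 := by
      have : 2 * a = 0 := by rw [hb] at htr; linear_combination htr
      simpa [h20] using this
    apply Subtype.ext
    rw [e, ha, hb]; simp
  · right
    have hb : b = -1 := by linear_combination hb
    have ha : a = t := by
      have : 2 * (a - t) = 0 := by rw [hb] at htr; linear_combination htr
      have := (mul_eq_zero.1 this).resolve_left h20
      linear_combination this
    apply Subtype.ext
    rw [e, ha, hb, SL_inv_val, ht']; simp [sub_eq_add_neg]

end field
end HallSL

namespace HallSL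
open Matrix

/-- solution of the orbit equation with sorted orbits -/
lemma arith_sorted (N a b c x y z : ℕ) (hN : 3 ≤ N) (h1 : a * x = N) (h2 : b * y = N) (h3 : c * z = N)
    (ha : 4 ≤ a) (hb : 4 ≤ b) (hc : 4 ≤ c) (ea : 2 ∣ a) (eb : 2 ∣ b) (ec : 2 ∣ c)
    (hs : 2 * (x + y + z) = N + 4) (hxy : y ≤ x) (hyz : z ≤ y) :
    2 * c = N ∨ (a = 4 ∧ b = 6 ∧ ((c = 6 ∧ N = 24) ∨ (c = 8 ∧ N = 48) ∨ (c = 10 ∧ N = 120))) := by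
  obtain ⟨a, rfl⟩ := ea
  obtain ⟨b, rfl⟩ := eb
  obtain ⟨c, rfl⟩ := ec
  have hx0 : 0 < x := by
    rcases Nat.eq_zero_or_pos x with rfl | h
    · omega
    · exact h
  have hy0 : 0 < y := by
    rcases Nat.eq_zero_or_pos y with rfl | h
    · omega
    · exact h
  have hz0 : 0 < z := by
    rcases Nat.eq_zero_or_pos z with rfl | h
    · omega
    · exact h
  have ha2 : a = 2 := by
    by_contra hne
    have : 3 ≤ a := by omega
    have : 3 * x ≤ a * x := Nat.mul_le_mul_right _ this
    nlinarith
  subst ha2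
  have hb3 : b < 4 := by
    by_contra hne
    have : 4 ≤ b := by omega
    have : 4 * y ≤ b * y := Nat.mul_le_mul_right _ this
    nlinarith
  have hb' : b = 2 ∨ b = 3 := by omega
  rcases hb' with rfl | rfl
  · left
    have : z = 2 := by omega
    subst this
    omega
  · right
    have hc6 : c < 6 := by
      by_contra hne
      have : 6 ≤ c := by omega
      have : 6 * z ≤ c * z := Nat.mul_le_mul_right _ this
      nlinarith
    have : c = 2 ∨ c = 3 ∨ c = 4 ∨ c = 5 := by omega
    rcases this with rfl | rfl | rfl | rfl <;> omega

def OrbConcl {Ω : Type*} (N : ℕ) (n : Ω → ℕ) : Prop :=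
    (∃ w, 2 * n w = N) ∨
    (N = 24 ∧ (∀ w, n w = 4 ∨ n w = 6) ∧ (∀ w w', n w = 4 → n w' = 4 → w = w')) ∨
    (N = 48 ∧ (∀ w, n w = 4 ∨ n w = 6 ∨ n w = 8) ∧ ∃ w, n w = 8) ∨
    (N = 120 ∧ (∀ w, n w = 4 ∨ n w = 6 ∨ n w = 10) ∧ (∀ w w', n w = n w' → w = w'))

lemma arith_concl {Ω : Type*} (N : ℕ) (n d : Ω → ℕ) (hN : 3 ≤ N) (hnd : ∀ w, n w * d w = N)
    (hn : ∀ w, 4 ≤ n w) (hn2 : ∀ w, 2 ∣ n w) (u v w : Ω) (hall : ∀ t, t = u ∨ t = v ∨ t = w)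
    (hs : 2 * (d u + d v + d w) = N + 4) (h1 : d v ≤ d u) (h2 : d w ≤ d v) :
    OrbConcl N n := by
  rcases arith_sorted N _ _ _ _ _ _ hN (hnd u) (hnd v) (hnd w) (hn u) (hn v) (hn w) (hn2 u) (hn2 v)
    (hn2 w) hs h1 h2 with h | ⟨ha, hb, ⟨hc, hN'⟩ | ⟨hc, hN'⟩ | ⟨hc, hN'⟩⟩
  · exact Or.inl ⟨w, h⟩
  · refine Or.inr (Or.inl ⟨hN', ?_, ?_⟩)
    · intro t; rcases hall t with rfl | rfl | rfl <;> omega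
    · intro t t' h h'
      rcases hall t with rfl | rfl | rfl <;> rcases hall t' with rfl | rfl | rfl <;>
        first | rfl | (exfalso; omega)
  · refine Or.inr (Or.inr (Or.inl ⟨hN', ?_, w, hc⟩))
    · intro t; rcases hall t with rfl | rfl | rfl <;> omega
  · refine Or.inr (Or.inr (Or.inr ⟨hN', ?_, ?_⟩))
    · intro t; rcases hall t with rfl | rfl | rfl <;> omega
    · intro t t' h
      rcases hall t with rfl | rfl | rfl <;> rcases hall t' with rfl | rfl | rfl <;>
        first | rfl | (exfalso; omega)

lemma arith {Ω : Type*} [Fintype Ω] (N : ℕ) (n d : Ω → ℕ) (hN : 3 ≤ N) (hnd : ∀ w, n w * d w = N)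
    (hn : ∀ w, 4 ≤ n w) (hn2 : ∀ w, 2 ∣ n w) (hne : ∀ w, n w ≠ N)
    (hs : 2 * ∑ w, d w + 2 * N = Fintype.card Ω * N + 4) : OrbConcl N n := by
  classical
  have hd0 : ∀ w, 0 < d w := fun w => by
    rcases Nat.eq_zero_or_pos (d w) with h | h
    · have := hnd w; rw [h] at this; omega
    · exact h
  have hd2 : ∀ w, 2 ≤ d w := fun w => by
    by_contra h
    have h1 : d w = 1 := by have := hd0 w; omega
    have := hnd w
    rw [h1] at this
    exact hne w (by omega)
  have hd4 : ∀ w, 4 * d w ≤ N := fun w => by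
    rw [← hnd w]; exact Nat.mul_le_mul_right _ (hn w)
  have hle : 4 * ∑ w, d w ≤ Fintype.card Ω * N := by
    rw [Finset.mul_sum]
    calc ∑ w, 4 * d w ≤ ∑ _w : Ω, N := Finset.sum_le_sum fun w _ => hd4 w
      _ = _ := by simp
  have hge : 2 * Fintype.card Ω ≤ ∑ w, d w := by
    calc 2 * Fintype.card Ω = ∑ _w : Ω, 2 := by simp [mul_comm]
      _ ≤ _ := Finset.sum_le_sum fun w _ => hd2 w
  have hk4 : Fintype.card Ω < 4 := by
    by_contra h
    have : 4 * N ≤ Fintype.card Ω * N := Nat.mul_le_mul_right _ (by omega)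
    omega
  have hk : Fintype.card Ω = 3 := by
    generalize Fintype.card Ω = k at *
    interval_cases k <;> omega
  rw [hk] at hs
  have hu : (Finset.univ : Finset Ω).card = 3 := hk
  obtain ⟨u, v, w, huv, huw, hvw, he⟩ := Finset.card_eq_three.1 hu
  have hall : ∀ t, t = u ∨ t = v ∨ t = w := fun t => by
    have := Finset.mem_univ t
    rw [he] at this
    simpa using this
  rw [he, Finset.sum_insert (by simp [huv, huw]), Finset.sum_insert (by simp [hvw]),
    Finset.sum_singleton] at hs
  rcases le_total (d u) (d v) with h1 | h1 <;> rcases le_total (d v) (d w) with h2 | h2 <;>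
    rcases le_total (d u) (d w) with h3 | h3
  · exact arith_concl N n d hN hnd hn hn2 w v u (fun t => by have := hall t; tauto) (by omega) h2 h1
  · exact arith_concl N n d hN hnd hn hn2 w v u (fun t => by have := hall t; tauto) (by omega) h2 h1
  · exact arith_concl N n d hN hnd hn hn2 v w u (fun t => by have := hall t; tauto) (by omega) h2 h3
  · exact arith_concl N n d hN hnd hn hn2 v u w (fun t => by have := hall t; tauto) (by omega) h1 h3
  · exact arith_concl N n d hN hnd hn hn2 w u v (fun t => by have := hall t; tauto) (by omega) h3 h1
  · exact arith_concl N n d hN hnd hn hn2 u w v (fun t => by have := hall t; tauto) (by omega) h3 h2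
  · exact arith_concl N n d hN hnd hn hn2 u v w (fun t => by have := hall t; tauto) (by omega) h1 h2
  · exact arith_concl N n d hN hnd hn hn2 u v w (fun t => by have := hall t; tauto) (by omega) h1 h2

end HallSL

namespace HallSL
open Matrix

section act
variable {H : Type*} [Group H] {K : Type*} [Field K]
  (ρ : H →* Matrix.SpecialLinearGroup (Fin 2) K) (z : H)

/-- matrix of a group element -/
def mt (h : H) : M2 K := (ρ h : M2 K)

lemma mt_mul (g h : H) : mt ρ (g * h) = mt ρ g * mt ρ h := by simp [mt]
lemma mt_one : mt ρ 1 = 1 := by simp [mt]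
lemma mt_inv_mul (g : H) : mt ρ g⁻¹ * mt ρ g = 1 := by rw [← mt_mul]; simp [mt_one]
lemma mt_mul_inv (g : H) : mt ρ g * mt ρ g⁻¹ = 1 := by rw [← mt_mul]; simp [mt_one]
lemma mt_det (g : H) : (mt ρ g).det = 1 := (ρ g).2

/-- the poles: rank one idempotents commuting with some noncentral element -/
def PX : Set (M2 K) := {e | e.trace = 1 ∧ e.det = 0 ∧ ∃ h : H, h ≠ 1 ∧ h ≠ z ∧ mt ρ h * e = e * mt ρ h}

lemma conj_comm_iff (g h : H) (e : M2 K) :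
    mt ρ h * e = e * mt ρ h ↔
    mt ρ (g * h * g⁻¹) * (mt ρ g * e * mt ρ g⁻¹) = (mt ρ g * e * mt ρ g⁻¹) * mt ρ (g * h * g⁻¹) := by
  have h1 : mt ρ (g * h * g⁻¹) * (mt ρ g * e * mt ρ g⁻¹) = mt ρ g * (mt ρ h * e) * mt ρ g⁻¹ := by
    rw [mt_mul, mt_mul]
    calc mt ρ g * mt ρ h * mt ρ g⁻¹ * (mt ρ g * e * mt ρ g⁻¹)
        = mt ρ g * mt ρ h * (mt ρ g⁻¹ * mt ρ g) * e * mt ρ g⁻¹ := by noncomm_ring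
      _ = _ := by rw [mt_inv_mul]; noncomm_ring
  have h2 : (mt ρ g * e * mt ρ g⁻¹) * mt ρ (g * h * g⁻¹) = mt ρ g * (e * mt ρ h) * mt ρ g⁻¹ := by
    rw [mt_mul, mt_mul]
    calc mt ρ g * e * mt ρ g⁻¹ * (mt ρ g * mt ρ h * mt ρ g⁻¹)
        = mt ρ g * e * (mt ρ g⁻¹ * mt ρ g) * mt ρ h * mt ρ g⁻¹ := by noncomm_ring
      _ = _ := by rw [mt_inv_mul]; noncomm_ring
  rw [h1, h2]
  constructor
  · intro h; rw [h]
  · intro h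
    have h' := congrArg (fun m => mt ρ g⁻¹ * m * mt ρ g) h
    have h3 : ∀ m : M2 K, mt ρ g⁻¹ * (mt ρ g * m * mt ρ g⁻¹) * mt ρ g = m := by
      intro m
      calc _ = (mt ρ g⁻¹ * mt ρ g) * m * (mt ρ g⁻¹ * mt ρ g) := by noncomm_ring
        _ = m := by rw [mt_inv_mul]; simp
    rwa [h3, h3] at h'

@[reducible] def pxAction (hzc : ∀ h, h * z = z * h) : MulAction H (PX ρ z) where
  smul g e := ⟨mt ρ g * e * mt ρ g⁻¹, by
    obtain ⟨e, h1, h2, h, h3, h4, h5⟩ := e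
    refine ⟨?_, ?_, g * h * g⁻¹, ?_, ?_, ?_⟩
    · simp only
      rw [Matrix.trace_mul_cycle, mt_inv_mul, one_mul, h1]
    · simp [h2]
    · intro h'; apply h3; simpa using h'
    · intro h'; apply h4
      have : h = g⁻¹ * (g * h * g⁻¹) * g := by group
      rw [this, h', mul_assoc, ← hzc]; group
    · exact (conj_comm_iff ρ g h e).1 h5⟩
  one_smul e := by
    apply Subtype.ext
    change mt ρ 1 * e * mt ρ 1⁻¹ = e
    simp [mt_one]
  mul_smul g h e := by
    apply Subtype.ext
    change mt ρ (g * h) * e * mt ρ (g * h)⁻¹ = mt ρ g * (mt ρ h * e * mt ρ h⁻¹) * mt ρ g⁻¹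
    rw [_root_.mul_inv_rev, mt_mul, mt_mul]
    noncomm_ring

lemma fix_iff (g : H) (e : M2 K) : mt ρ g * e * mt ρ g⁻¹ = e ↔ mt ρ g * e = e * mt ρ g := by
  constructor
  · intro h
    calc mt ρ g * e = mt ρ g * e * (mt ρ g⁻¹ * mt ρ g) := by rw [mt_inv_mul, mul_one]
      _ = (mt ρ g * e * mt ρ g⁻¹) * mt ρ g := by noncomm_ring
      _ = _ := by rw [h]
  · intro h
    rw [h, mul_assoc, mt_mul_inv, mul_one]

variable {ρ z}

lemma pole_nonscalar {e : M2 K} (h1 : e.trace = 1) (hd : e.det = 0) (c : K) :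
    e ≠ c • 1 := by
  rintro rfl
  simp at hd
  simp [hd] at h1

lemma mt_nonscalar (hρ : Function.Injective ρ) (hz : ρ z = -1) {h : H} (h1 : h ≠ 1) (h2 : h ≠ z)
    (c : K) : mt ρ h ≠ c • 1 := by
  apply nonscalar_SL
  · intro e; exact h1 (hρ (by simpa using e))
  · intro e; exact h2 (hρ (by rw [e, hz]))

lemma mt_z (hz : ρ z = -1) : mt ρ z = -1 := by simp [mt, hz]

lemma z_comm (hρ : Function.Injective ρ) (hz : ρ z = -1) (h : H) : h * z = z * h := by
  apply hρ; rw [map_mul, map_mul, hz]; simp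

lemma z_ne_one (h2 : (2 : K) ≠ 0) (hz : ρ z = -1) : z ≠ 1 := by
  rintro rfl
  have := congrArg (fun m : Matrix.SpecialLinearGroup (Fin 2) K => (m : M2 K) 0 0) hz
  simp at this
  apply h2
  linear_combination this

lemma trace_two_pow {M : M2 K} (hd : M.det = 1) (ht : M.trace = 2) (k : ℕ) :
    M ^ k = 1 + (k : K) • (M - 1) := by
  have hsq : (M - 1) * (M - 1) = 0 := by
    have := cayley M
    rw [hd, ht] at this
    have e : (M - 1) * (M - 1) = M * M - (2 : K) • M + 1 := by
      rw [two_smul]; noncomm_ring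
    rw [e, this]; simp
  induction k with
  | zero => simp
  | succ k ih =>
    have : M = 1 + (M - 1) := by abel
    rw [pow_succ, ih]
    nth_rewrite 2 [this]
    rw [mul_add, mul_one, add_mul, one_mul, smul_mul_assoc, hsq, smul_zero, add_zero]
    push_cast
    rw [add_smul, one_smul]
    abel

lemma trace_ne_two [Finite H] (hρ : Function.Injective ρ) (hN : (Nat.card H : K) ≠ 0) {h : H} (h1 : h ≠ 1) :
    (mt ρ h).trace ≠ 2 := by
  intro ht
  have e := trace_two_pow (mt_det ρ h) ht (Nat.card H)
  have e2 : (mt ρ h) ^ Nat.card H = 1 := by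
    have : ∀ k : ℕ, (mt ρ h) ^ k = mt ρ (h ^ k) := by
      intro k
      simp [mt]
    rw [this, pow_card_eq_one', mt_one]
  rw [e2] at e
  have e3 : (Nat.card H : K) • (mt ρ h - 1) = 0 := by
    have := e.symm
    rwa [add_eq_left] at this
  have e4 := (smul_eq_zero.1 e3).resolve_left hN
  apply h1
  apply hρ
  apply Subtype.ext
  rw [sub_eq_zero] at e4
  rw [map_one]
  exact e4

lemma trace_sq_ne [Finite H] (hρ : Function.Injective ρ) (hz : ρ z = -1)
    (hN : (Nat.card H : K) ≠ 0) {h : H} (h1 : h ≠ 1) (h2 : h ≠ z) : (mt ρ h).trace ^ 2 ≠ 4 := by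
  intro ht
  have : ((mt ρ h).trace - 2) * ((mt ρ h).trace + 2) = 0 := by linear_combination ht
  rcases mul_eq_zero.1 this with h' | h'
  · exact trace_ne_two hρ hN h1 (by linear_combination h')
  · have hz2 : z * z = 1 := by apply hρ; rw [map_mul, hz]; simp
    have : z * h ≠ 1 := by
      intro e
      apply h2
      calc h = z * z * h := by rw [hz2, one_mul]
        _ = z * (z * h) := by rw [mul_assoc]
        _ = z := by rw [e, mul_one]
    apply trace_ne_two hρ hN this
    rw [mt_mul, mt_z hz]
    simp
    linear_combination -h'

lemma two_fixed [IsAlgClosed K] (h20 : (2 : K) ≠ 0) {M : M2 K} (hd : M.det = 1)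
    (hM : ∀ c : K, M ≠ c • 1) (ht : M.trace ^ 2 ≠ 4) :
    ∃ e : M2 K, e ≠ 1 - e ∧ e.trace = 1 ∧ e.det = 0 ∧ (1 - e).trace = 1 ∧ (1 - e).det = 0 ∧
      M * e = e * M ∧ M * (1 - e) = (1 - e) * M ∧
      ∀ f : M2 K, f.trace = 1 → f.det = 0 → M * f = f * M → f = e ∨ f = 1 - e := by
  obtain ⟨δ, hδ⟩ := IsAlgClosed.exists_pow_nat_eq (M.trace ^ 2 - 4) (n := 2) (by norm_num)
  have hδ0 : δ ≠ 0 := by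
    rintro rfl
    apply ht
    linear_combination -hδ
  set t := M.trace with htt
  set b : K := δ⁻¹ with hb
  set a : K := (1 - b * t) / 2 with ha
  have h2a : 2 * a = 1 - b * t := by rw [ha]; field_simp
  have hb2 : b ^ 2 * (t ^ 2 - 4) = 1 := by rw [← hδ, hb]; field_simp
  have h40 : (4 : K) ≠ 0 := by
    have : (4 : K) = 2 * 2 := by norm_num
    rw [this]; exact mul_ne_zero h20 h20
  have he1 : (a • (1 : M2 K) + b • M).trace = 1 := by rw [tr_lin]; linear_combination h2a
  have he2 : (a • (1 : M2 K) + b • M).det = 0 := by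
    rw [det_lin _ hd]
    have : 4 * (a ^ 2 + a * b * M.trace + b ^ 2) = 0 := by
      rw [← htt]
      linear_combination (2 * a + b * t + 1) * h2a - hb2
    exact (mul_eq_zero.1 this).resolve_left h40
  have hcomm : M * (a • (1 : M2 K) + b • M) = (a • (1 : M2 K) + b • M) * M := by
    simp [mul_add, add_mul]
  have hf1 : (1 - (a • (1 : M2 K) + b • M)).trace = 1 := by
    rw [Matrix.trace_sub, he1]; simp; norm_num
  have hdet1 : ∀ e : M2 K, e.trace = 1 → e.det = 0 → (1 - e).det = 0 := by
    intro e h1 h2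
    rw [Matrix.trace_fin_two] at h1
    rw [Matrix.det_fin_two] at h2 ⊢
    simp
    linear_combination h2 - h1
  refine ⟨a • 1 + b • M, ?_, he1, he2, hf1, hdet1 _ he1 he2, hcomm, ?_, ?_⟩
  · intro h
    have : (2 : K) • (a • (1 : M2 K) + b • M) = 1 := by
      rw [two_smul]; nth_rewrite 1 [h]; abel
    have := congrArg Matrix.det this
    rw [Matrix.det_smul, he2] at this
    simp at this
  · rw [mul_sub, sub_mul, hcomm]; simp
  · intro f hf1 hf2 hfc
    obtain ⟨α, β, rfl⟩ := comm_span hM hfc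
    rw [tr_lin] at hf1
    rw [det_lin _ hd] at hf2
    rw [← htt] at hf1 hf2
    have hβ : β ^ 2 * (t ^ 2 - 4) = 1 := by
      linear_combination (-4) * hf2 + (2 * α + β * t + 1) * hf1
    have : (β - b) * (β + b) = 0 := by
      have : (t ^ 2 - 4) * ((β - b) * (β + b)) = 0 := by linear_combination hβ - hb2
      exact (mul_eq_zero.1 this).resolve_left (sub_ne_zero.2 ht)
    rcases mul_eq_zero.1 this with h | h
    · left
      have hβ' : β = b := by linear_combination h
      have : α = a := by
        apply mul_left_cancel₀ h20
        rw [hβ'] at hf1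
        linear_combination hf1 - h2a
      rw [hβ', this]
    · right
      have hβ' : β = -b := by linear_combination h
      have : α = 1 - a := by
        apply mul_left_cancel₀ h20
        rw [hβ'] at hf1
        linear_combination hf1 + h2a
      rw [hβ', this, sub_smul, one_smul, neg_smul]
      abel

end act
end HallSL

namespace HallSL
open Matrix

section thm1
variable {H : Type*} [Group H] [Finite H] {K : Type*} [Field K] [IsAlgClosed K]
  {ρ : H →* Matrix.SpecialLinearGroup (Fin 2) K} {z : H}

lemma comm_of_mt (hρ : Function.Injective ρ) {x y : H} (h : mt ρ x * mt ρ y = mt ρ y * mt ρ x) :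
    x * y = y * x := by
  apply hρ
  apply Subtype.ext
  rw [← mt_mul, ← mt_mul] at h
  exact h

lemma mt_of_comm {x y : H} (h : x * y = y * x) : mt ρ x * mt ρ y = mt ρ y * mt ρ x := by
  rw [← mt_mul, ← mt_mul, h]

lemma exists_pole (h20 : (2 : K) ≠ 0) (hρ : Function.Injective ρ) (hz : ρ z = -1)
    (hN : (Nat.card H : K) ≠ 0) {x : H} (h1 : x ≠ 1) (h2 : x ≠ z) :
    ∃ e : PX ρ z, ∃ f : PX ρ z, e ≠ f ∧ (f : M2 K) = 1 - e ∧ mt ρ x * e = e * mt ρ x ∧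
      mt ρ x * f = f * mt ρ x ∧ ∀ g : PX ρ z, mt ρ x * g = g * mt ρ x → g = e ∨ g = f := by
  obtain ⟨e, hne, t1, d1, t2, d2, c1, c2, huniq⟩ := two_fixed h20 (mt_det ρ x)
    (mt_nonscalar hρ hz h1 h2) (trace_sq_ne hρ hz hN h1 h2)
  refine ⟨⟨e, t1, d1, x, h1, h2, c1⟩, ⟨1 - e, t2, d2, x, h1, h2, c2⟩, ?_, rfl, c1, c2, ?_⟩
  · intro h; exact hne (congrArg Subtype.val h)
  · intro g hg
    rcases huniq g g.2.1 g.2.2.1 hg with h | h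
    · left; exact Subtype.ext h
    · right; exact Subtype.ext h

lemma finite_PX (h20 : (2 : K) ≠ 0) (hρ : Function.Injective ρ) (hz : ρ z = -1)
    (hN : (Nat.card H : K) ≠ 0) : Finite (PX ρ z) := by
  have : (Set.univ : Set (PX ρ z)) ⊆ ⋃ x : H, {g : PX ρ z | x ≠ 1 ∧ x ≠ z ∧ mt ρ x * g = g * mt ρ x} := by
    rintro ⟨g, t, d, x, h1, h2, c⟩ -
    exact Set.mem_iUnion.2 ⟨x, h1, h2, c⟩
  apply Set.finite_univ_iff.1
  apply Set.Finite.subset _ this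
  apply Set.finite_iUnion
  intro x
  by_cases h1 : x = 1
  · simp [h1]
  by_cases h2 : x = z
  · simp [h2]
  obtain ⟨e, f, -, -, -, -, hu⟩ := exists_pole h20 hρ hz hN h1 h2
  apply (Set.toFinite {e, f}).subset
  rintro g ⟨-, -, hg⟩
  exact hu g hg

def T4 (H : Type*) [Group H] (z : H) : Prop :=
  (∀ x : H, x * x = z → Nat.card (Subgroup.centralizer {x}) = 4) ∧
  ∀ x y : H, x * x = z → y * y = z → ∃ h, h * x * h⁻¹ = y ∨ h * x * h⁻¹ = y⁻¹

lemma four_dvd {H : Type*} [Group H] [Finite H] {z : H} (hz1 : z ≠ 1) (hz2 : z * z = 1) {x : H}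
    (hx : x * x = z) (S : Subgroup H) (hS : x ∈ S) : 4 ∣ Nat.card S := by
  have ho : orderOf x = 2 ^ (1 + 1) := by
    apply orderOf_eq_prime_pow
    · simp [pow_two, hx, hz1]
    · rw [pow_add, pow_mul]
      simp [pow_two, hx, hz2]
  have := S.orderOf_dvd_natCard hS
  rwa [ho] at this

theorem thm1 (h20 : (2 : K) ≠ 0) (hρ : Function.Injective ρ) (hz : ρ z = -1)
    (hN : (Nat.card H : K) ≠ 0) (hna : ∃ a b : H, a * b ≠ b * a) :
    (∃ A : Subgroup H, (∀ a ∈ A, ∀ b ∈ A, a * b = b * a) ∧ 2 * Nat.card A = Nat.card H) ∨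
    (Nat.card H = 24 ∧ T4 H z) ∨
    (Nat.card H = 48 ∧ (∀ x : H, x ≠ 1 → x ≠ z → Nat.card (Subgroup.centralizer {x}) = 4 ∨
        Nat.card (Subgroup.centralizer {x}) = 6 ∨ Nat.card (Subgroup.centralizer {x}) = 8) ∧
      ∃ x : H, x ≠ 1 ∧ x ≠ z ∧ Nat.card (Subgroup.centralizer {x}) = 8) ∨
    (Nat.card H = 120 ∧ (∀ x : H, x ≠ 1 → x ≠ z → Nat.card (Subgroup.centralizer {x}) = 4 ∨
        Nat.card (Subgroup.centralizer {x}) = 6 ∨ Nat.card (Subgroup.centralizer {x}) = 10) ∧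
      T4 H z ∧ ∀ x : H, x ≠ 1 → x ≠ z → ∃ y, y * x * y⁻¹ = x⁻¹) := by
  classical
  have hzc := z_comm hρ hz
  have hz1 := z_ne_one h20 hz
  have hz2 : z * z = 1 := by apply hρ; rw [map_mul, hz]; simp
  haveI := finite_PX h20 hρ hz hN
  letI := pxAction ρ z hzc
  haveI : Fintype H := Fintype.ofFinite H
  haveI : Fintype (PX ρ z) := Fintype.ofFinite _
  have hsm : ∀ (g : H) (e : PX ρ z), ((g • e : PX ρ z) : M2 K) = mt ρ g * e * mt ρ g⁻¹ :=
    fun g e => rfl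
  have hfix : ∀ (g : H) (e : PX ρ z), g • e = e ↔ mt ρ g * e = e * mt ρ g := by
    intro g e
    rw [← fix_iff, ← hsm, Subtype.ext_iff]
  have hstab : ∀ (g : H) (e : PX ρ z), g ∈ MulAction.stabilizer H e ↔ mt ρ g * e = e * mt ρ g := by
    intro g e
    rw [MulAction.mem_stabilizer_iff, hfix]
  have hns : ∀ e : PX ρ z, ∀ c : K, (e : M2 K) ≠ c • 1 := fun e => pole_nonscalar e.2.1 e.2.2.1
  -- stabilizers are abelian
  have hab : ∀ e : PX ρ z, ∀ a ∈ MulAction.stabilizer H e, ∀ b ∈ MulAction.stabilizer H e,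
      a * b = b * a := by
    intro e a ha b hb
    rw [hstab] at ha hb
    exact comm_of_mt hρ (comm_trans (hns e) ha.symm hb.symm)
  -- stabilizers are centralizers
  have hcent : ∀ e : PX ρ z, ∀ x ∈ MulAction.stabilizer H e, x ≠ 1 → x ≠ z →
      MulAction.stabilizer H e = Subgroup.centralizer {x} := by
    intro e x hx h1 h2
    ext y
    rw [Subgroup.mem_centralizer_singleton_iff]
    constructor
    · intro hy; exact hab e y hy x hx
    · intro hy
      rw [hstab] at hx ⊢
      exact comm_trans (mt_nonscalar hρ hz h1 h2) (mt_of_comm hy.symm) hx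
  have hz_stab : ∀ e : PX ρ z, z ∈ MulAction.stabilizer H e := by
    intro e; rw [hstab, mt_z hz]; simp
  have hn2 : ∀ e : PX ρ z, 2 ∣ Nat.card (MulAction.stabilizer H e) := by
    intro e
    have ho : orderOf z = 2 := orderOf_eq_prime (by rw [pow_two, hz2]) hz1
    have := (MulAction.stabilizer H e).orderOf_dvd_natCard (hz_stab e)
    rwa [ho] at this
  have hn4 : ∀ e : PX ρ z, 4 ≤ Nat.card (MulAction.stabilizer H e) := by
    intro e
    obtain ⟨x, h1, h2, hx⟩ := e.2.2.2
    have h3 : 3 ≤ Nat.card (MulAction.stabilizer H e) := by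
      have hsub : ({1, z, x} : Set H) ⊆ (MulAction.stabilizer H e : Set H) := by
        rintro y (rfl | rfl | rfl)
        · exact one_mem _
        · exact hz_stab e
        · exact (hstab _ _).2 hx
      have hcard := Set.ncard_le_ncard hsub (Set.toFinite _)
      rw [Set.ncard_eq_three.2 ⟨1, z, x, hz1.symm, h1.symm, h2.symm, rfl⟩] at hcard
      exact hcard
    have := hn2 e
    omega
  have hgt : 3 ≤ Nat.card H := by
    obtain ⟨a, b, hab'⟩ := hna
    have h1 : a ≠ 1 := by rintro rfl; simp at hab'
    have h2 : a ≠ z := by rintro rfl; exact hab' (hzc b).symm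
    obtain ⟨e, -⟩ := exists_pole h20 hρ hz hN h1 h2
    have := Nat.le_of_dvd Nat.card_pos (Subgroup.card_subgroup_dvd_card (MulAction.stabilizer H e))
    have := hn4 e
    omega
  -- Burnside
  have hB := MulAction.sum_card_fixedBy_eq_card_orbits_mul_card_group H (PX ρ z)
  have hX := MulAction.card_eq_sum_card_group_div_card_stabilizer H (PX ρ z)
  have hf1 : ∀ g : H, g = 1 ∨ g = z → Fintype.card (MulAction.fixedBy (PX ρ z) g) = Fintype.card (PX ρ z) := by
    intro g hg
    apply Fintype.card_congr
    apply (Equiv.subtypeUnivEquiv _)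
    intro e
    rw [MulAction.mem_fixedBy, hfix]
    rcases hg with rfl | rfl
    · simp [mt_one]
    · simp [mt_z hz]
  have hf2 : ∀ g : H, g ≠ 1 → g ≠ z → Fintype.card (MulAction.fixedBy (PX ρ z) g) = 2 := by
    intro g h1 h2
    obtain ⟨e, f, hne, -, he, hf, hu⟩ := exists_pole h20 hρ hz hN h1 h2
    have : MulAction.fixedBy (PX ρ z) g = {e, f} := by
      ext y
      rw [MulAction.mem_fixedBy, hfix]
      constructor
      · exact hu y
      · rintro (rfl | rfl) <;> assumption
    rw [← Nat.card_eq_fintype_card, Nat.card_coe_set_eq, this, Set.ncard_pair hne]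
  have hsum : ∑ g : H, Fintype.card (MulAction.fixedBy (PX ρ z) g) + 4 =
      2 * Fintype.card (PX ρ z) + 2 * Nat.card H := by
    rw [← Finset.add_sum_erase _ _ (Finset.mem_univ (1 : H)),
      ← Finset.add_sum_erase _ _ (Finset.mem_erase.2 ⟨hz1, Finset.mem_univ z⟩),
      hf1 1 (Or.inl rfl), hf1 z (Or.inr rfl)]
    rw [Finset.sum_congr rfl (g := fun _ => 2)]
    · rw [Finset.sum_const, Finset.card_erase_of_mem (Finset.mem_erase.2 ⟨hz1, Finset.mem_univ z⟩),
        Finset.card_erase_of_mem (Finset.mem_univ _), Finset.card_univ]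
      have hcH : Fintype.card H = Nat.card H := Nat.card_eq_fintype_card.symm
      have hc2 : 2 ≤ Fintype.card H := by
        have := Finset.card_le_univ ({1, z} : Finset H)
        rwa [Finset.card_pair (Ne.symm hz1)] at this
      simp only [smul_eq_mul]
      omega
    · intro g hg
      rw [Finset.mem_erase, Finset.mem_erase] at hg
      exact hf2 g hg.2.1 hg.1
  have hconc : OrbConcl (Nat.card H)
      (fun w : Quotient (MulAction.orbitRel H (PX ρ z)) => Nat.card (MulAction.stabilizer H w.out)) := by
    apply arith (d := fun w => Nat.card H / Nat.card (MulAction.stabilizer H w.out)) _ _ hgt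
    · intro w
      exact Nat.mul_div_cancel' (Subgroup.card_subgroup_dvd_card _)
    · intro w; exact hn4 _
    · intro w; exact hn2 _
    · intro w h
      obtain ⟨a, b, hab'⟩ := hna
      have := Subgroup.eq_top_of_card_eq _ h
      apply hab'
      apply hab w.out <;> rw [this] <;> trivial
    · simp only [← Nat.card_eq_fintype_card] at hB hX hsum ⊢
      rw [hX] at hsum
      rw [← hsum, hB]
  -- transfer from orbits to poles
  have horb : ∀ e : PX ρ z, ∃ w : Quotient (MulAction.orbitRel H (PX ρ z)),
      Nat.card (MulAction.stabilizer H e) = Nat.card (MulAction.stabilizer H w.out) ∧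
      Quotient.mk'' e = w := by
    intro e
    refine ⟨Quotient.mk'' e, ?_, rfl⟩
    have : MulAction.orbitRel H (PX ρ z) e (Quotient.mk'' e : Quotient (MulAction.orbitRel H (PX ρ z))).out :=
      (Setoid.symm' _ (Quotient.mk_out (s := MulAction.orbitRel H (PX ρ z)) e))
    exact Nat.card_congr (MulAction.stabilizerEquivStabilizerOfOrbitRel this).toEquiv
  have hsame : ∀ e f : PX ρ z, (Quotient.mk'' e : Quotient (MulAction.orbitRel H (PX ρ z))) = Quotient.mk'' f →
      ∃ g : H, g • e = f := by
    intro e f h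
    have h' : MulAction.orbitRel H (PX ρ z) f e := Quotient.eq''.1 h.symm
    exact h'
  have hconjst : ∀ (g : H) (e f : PX ρ z), g • e = f → ∀ x ∈ MulAction.stabilizer H e,
      g * x * g⁻¹ ∈ MulAction.stabilizer H f := by
    rintro g e _ rfl x hx
    rw [MulAction.mem_stabilizer_iff] at hx ⊢
    rw [mul_smul, mul_smul, inv_smul_smul, hx]
  have hex : ∀ x : H, x ≠ 1 → x ≠ z → ∃ e : PX ρ z, x ∈ MulAction.stabilizer H e ∧
      MulAction.stabilizer H e = Subgroup.centralizer {x} := by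
    intro x h1 h2
    obtain ⟨e, f, -, -, he, -, -⟩ := exists_pole h20 hρ hz hN h1 h2
    have he' := (hstab x e).2 he
    exact ⟨e, he', hcent e x he' h1 h2⟩
  have hsqne : ∀ x : H, x * x = z → x ≠ 1 ∧ x ≠ z := by
    intro x hx
    constructor
    · rintro rfl; exact hz1 (by rw [← hx, one_mul])
    · rintro rfl; exact hz1 (by rw [← hx, hz2])
  have hT4 : (∀ e : PX ρ z, 4 ∣ Nat.card (MulAction.stabilizer H e) → Nat.card (MulAction.stabilizer H e) = 4) →
      (∀ e f : PX ρ z, Nat.card (MulAction.stabilizer H e) = 4 → Nat.card (MulAction.stabilizer H f) = 4 →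
        (Quotient.mk'' e : Quotient (MulAction.orbitRel H (PX ρ z))) = Quotient.mk'' f) → T4 H z := by
    intro h4 hs
    refine ⟨?_, ?_⟩
    · intro x hx
      obtain ⟨h1, h2⟩ := hsqne x hx
      obtain ⟨e, he, hc⟩ := hex x h1 h2
      rw [← hc]
      exact h4 e (four_dvd hz1 hz2 hx _ he)
    · intro x y hx hy
      obtain ⟨h1, h2⟩ := hsqne x hx
      obtain ⟨h3, h4'⟩ := hsqne y hy
      obtain ⟨e, he, hc⟩ := hex x h1 h2
      obtain ⟨f, hf, hc'⟩ := hex y h3 h4'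
      obtain ⟨g, hg⟩ := hsame e f (hs e f (h4 e (four_dvd hz1 hz2 hx _ he)) (h4 f (four_dvd hz1 hz2 hy _ hf)))
      have hw := hconjst g e f hg x he
      have hcm := hab f _ hw _ hf
      have hww : (g * x * g⁻¹) * (g * x * g⁻¹) = z := by
        calc (g * x * g⁻¹) * (g * x * g⁻¹) = g * (x * x) * g⁻¹ := by group
          _ = z := by rw [hx, hzc]; group
      refine ⟨g, ?_⟩
      generalize g * x * g⁻¹ = w at *
      have hs : (w * y) * (w * y) = 1 := by
        calc w * y * (w * y) = w * (y * w) * y := by group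
          _ = (w * w) * (y * y) := by rw [← hcm]; group
          _ = 1 := by rw [hww, hy, hz2]
      have hs' : ρ (w * y) * ρ (w * y) = 1 := by rw [← map_mul, hs, map_one]
      rcases SL_sq_one h20 hs' with h | h
      · right
        exact eq_inv_of_mul_eq_one_left (hρ (by rw [h, map_one]))
      · left
        have : w * y = z := hρ (by rw [h, hz])
        have hh : w * y = y * y := by rw [this, hy]
        exact mul_right_cancel hh
  have hC : ∀ P : ℕ → Prop, (∀ w : Quotient (MulAction.orbitRel H (PX ρ z)),
      P (Nat.card (MulAction.stabilizer H w.out))) → ∀ e : PX ρ z, P (Nat.card (MulAction.stabilizer H e)) := by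
    intro P hP e
    obtain ⟨w, hw, -⟩ := horb e
    rw [hw]; exact hP w
  rcases hconc with ⟨w, hw⟩ | ⟨hc, hall, hu⟩ | ⟨hc, hall, w, hw⟩ | ⟨hc, hall, hu⟩
  · left
    exact ⟨_, hab w.out, hw⟩
  · right; left
    refine ⟨hc, hT4 ?_ ?_⟩
    · intro e he
      have := hC (fun n => n = 4 ∨ n = 6) hall e
      omega
    · intro e f he hf
      obtain ⟨w, h1, rfl⟩ := horb e
      obtain ⟨w', h1', rfl⟩ := horb f
      exact hu _ _ (by dsimp only; rw [← h1, he]) (by dsimp only; rw [← h1', hf])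
  · right; right; left
    refine ⟨hc, ?_, ?_⟩
    · intro x h1 h2
      obtain ⟨e, he, hce⟩ := hex x h1 h2
      rw [← hce]
      exact hC (fun n => n = 4 ∨ n = 6 ∨ n = 8) hall e
    · obtain ⟨x, h1, h2, hx⟩ := w.out.2.2.2
      refine ⟨x, h1, h2, ?_⟩
      rw [← hcent w.out x ((hstab _ _).2 hx) h1 h2]
      exact hw
  · right; right; right
    have hinj : ∀ e f : PX ρ z, Nat.card (MulAction.stabilizer H e) = Nat.card (MulAction.stabilizer H f) →
        (Quotient.mk'' e : Quotient (MulAction.orbitRel H (PX ρ z))) = Quotient.mk'' f := by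
      intro e f he
      obtain ⟨w, h1, rfl⟩ := horb e
      obtain ⟨w', h1', rfl⟩ := horb f
      exact hu _ _ (by dsimp only; rw [← h1, ← h1', he])
    refine ⟨hc, ?_, hT4 ?_ ?_, ?_⟩
    · intro x h1 h2
      obtain ⟨e, he, hce⟩ := hex x h1 h2
      rw [← hce]
      exact hC (fun n => n = 4 ∨ n = 6 ∨ n = 10) hall e
    · intro e he
      have := hC (fun n => n = 4 ∨ n = 6 ∨ n = 10) hall e
      omega
    · intro e f he hf
      exact hinj e f (by rw [he, hf])
    · intro x h1 h2
      obtain ⟨e, f, hne, hf, he1, hf1, -⟩ := exists_pole h20 hρ hz hN h1 h2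
      have he' := (hstab x e).2 he1
      have hf' := (hstab x f).2 hf1
      obtain ⟨g, hg⟩ := hsame e f (hinj e f (by
        rw [hcent e x he' h1 h2, hcent f x hf' h1 h2]))
      have hw := hconjst g e f hg x he'
      have hcm := hab f _ hw _ hf'
      have htr : (mt ρ (g * x * g⁻¹)).trace = (mt ρ x).trace := by
        rw [mt_mul, mt_mul, Matrix.trace_mul_cycle, mt_inv_mul, one_mul]
      have hx1 : ρ x ≠ 1 := fun h => h1 (hρ (by rw [h, map_one]))
      have hx2 : ρ x ≠ -1 := fun h => h2 (hρ (by rw [h, hz]))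
      rcases SL_same_trace h20 (x := ρ x) (z := ρ (g * x * g⁻¹)) hx1 hx2
        (trace_sq_ne hρ hz hN h1 h2) (by rw [← map_mul, ← map_mul, hcm]) htr with h | h
      · exfalso
        have h' := hρ h
        have hgx : g ∈ Subgroup.centralizer {x} := by
          rw [Subgroup.mem_centralizer_singleton_iff]
          calc g * x = (g * x * g⁻¹) * g := by group
            _ = x * g := by rw [h']
        rw [← hcent e x he' h1 h2, MulAction.mem_stabilizer_iff] at hgx
        exact hne (hgx.symm.trans hg)
      · exact ⟨g, hρ (by rw [h, map_inv])⟩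

end thm1
end HallSL

namespace HallSL

set_option linter.unusedSectionVars false
set_option linter.style.haveILetI false

section hall
variable {G : Type*} [Group G] {π : Set ℕ}

lemma mem_conjSub {g x : G} {H : Subgroup G} : x ∈ conjSub g H ↔ g⁻¹ * x * g ∈ H := by
  unfold conjSub
  rw [Subgroup.mem_map]
  constructor
  · rintro ⟨y, hy, rfl⟩
    simpa [mul_assoc] using hy
  · intro h
    exact ⟨_, h, by simp [mul_assoc]⟩

lemma conjSub_mul (a b : G) (H : Subgroup G) : conjSub a (conjSub b H) = conjSub (a * b) H := by
  ext x
  simp only [mem_conjSub, mul_inv_rev, mul_assoc]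

lemma conjSub_one (H : Subgroup G) : conjSub 1 H = H := by
  ext x
  simp [mem_conjSub]

lemma conjSub_card (g : G) (H : Subgroup G) : Nat.card (conjSub g H) = Nat.card H := by
  unfold conjSub
  exact Subgroup.card_map_of_injective (MulAut.conj g).injective

lemma conjSub_index (g : G) (H : Subgroup G) : (conjSub g H).index = H.index := by
  unfold conjSub
  exact Subgroup.index_map_equiv H (MulAut.conj g)

lemma hall_conj {H : Subgroup G} (g : G) (h : IsHallPi π H) : IsHallPi π (conjSub g H) := by
  unfold IsHallPi
  rw [conjSub_card, conjSub_index]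
  exact h

def Cj (H H' : Subgroup G) : Prop := ∃ g, conjSub g H = H'

lemma Cj.symm {H H' : Subgroup G} (h : Cj H H') : Cj H' H := by
  obtain ⟨g, rfl⟩ := h
  exact ⟨g⁻¹, by rw [conjSub_mul, inv_mul_cancel, conjSub_one]⟩

lemma Cj.trans {H H' H'' : Subgroup G} (h : Cj H H') (h' : Cj H' H'') : Cj H H'' := by
  obtain ⟨g, rfl⟩ := h
  obtain ⟨k, rfl⟩ := h'
  exact ⟨k * g, by rw [conjSub_mul]⟩

/-- reduce conjugacy to conjugates -/
lemma Cj.of_conj {H H' : Subgroup G} {a b : G} (h : Cj (conjSub a H) (conjSub b H')) : Cj H H' :=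
  (Cj.trans ⟨a, rfl⟩ h).trans (Cj.symm ⟨b, rfl⟩)

variable [Finite G]

lemma hall_coprime {H H' : Subgroup G} (h : IsHallPi π H) (h' : IsHallPi π H') :
    Nat.Coprime (Nat.card H) H'.index := by
  apply Nat.coprime_of_dvd
  intro k hk h1 h2
  exact h'.2 k (h.1 k hk h1) hk h2

lemma hall_dvd {H H' : Subgroup G} (h : IsHallPi π H) (h' : IsHallPi π H') :
    Nat.card H ∣ Nat.card H' := by
  have : Nat.card H ∣ Nat.card H' * H'.index := by
    rw [Subgroup.card_mul_index]; exact Subgroup.card_subgroup_dvd_card H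
  exact (hall_coprime h h').dvd_of_dvd_mul_right this

lemma hall_card {H H' : Subgroup G} (h : IsHallPi π H) (h' : IsHallPi π H') :
    Nat.card H = Nat.card H' := Nat.dvd_antisymm (hall_dvd h h') (hall_dvd h' h)

lemma eq_of_le_of_card {H H' : Subgroup G} (h : H ≤ H') (hc : Nat.card H = Nat.card H') : H = H' :=
  Subgroup.eq_of_le_of_card_ge h hc.ge

lemma hall_sylow {r : ℕ} (hr : r.Prime) (hrπ : r ∈ π) {P H : Subgroup G} (hP : IsPGroup r P)
    (h : IsHallPi π H) : ∃ g, P ≤ conjSub g H := by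
  haveI := Fact.mk hr
  have hnd : ¬ r ∣ Nat.card (G ⧸ H) := h.2 r hrπ hr
  obtain ⟨x, hx⟩ := hP.nonempty_fixed_point_of_prime_not_dvd_card (G ⧸ H) hnd
  obtain ⟨g, rfl⟩ := QuotientGroup.mk_surjective x
  refine ⟨g, ?_⟩
  intro p hp
  have h1 : ((p * g : G) : G ⧸ H) = (g : G ⧸ H) := hx ⟨p, hp⟩
  rw [mem_conjSub]
  have := QuotientGroup.eq.1 h1.symm
  simpa [mul_assoc] using this

lemma count (D R : Subgroup G → Prop) (hE : ∃ H : Subgroup G, IsHallPi π H)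
    (hD : ∀ H H', IsHallPi π H → IsHallPi π H' → D H → D H' → Cj H H')
    (hR : ∀ H H', IsHallPi π H → IsHallPi π H' → ¬ D H → ¬ D H' → (R H ↔ R H') → Cj H H') :
    kPi π G ∈ ({1, 2, 3} : Set ℕ) := by
  classical
  unfold kPi
  set X := {O : Set (Subgroup G) // ∃ H : Subgroup G, IsHallPi π H ∧ O = {K | ∃ g : G, conjSub g H = K}}
  choose hh hh1 hh2 using fun O : X => O.2
  let f : X → Fin 3 := fun O => if D (hh O) then 0 else if R (hh O) then 1 else 2
  have hf : Function.Injective f := by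
    intro O O' hO
    have hc : Cj (hh O) (hh O') := by
      simp only [f] at hO
      by_cases h1 : D (hh O) <;> by_cases h2 : D (hh O')
      · exact hD _ _ (hh1 O) (hh1 O') h1 h2
      · rw [if_pos h1, if_neg h2] at hO; split_ifs at hO <;> simp at hO
      · rw [if_pos h2, if_neg h1] at hO; split_ifs at hO <;> simp at hO
      · rw [if_neg h1, if_neg h2] at hO
        refine hR _ _ (hh1 O) (hh1 O') h1 h2 ?_
        split_ifs at hO with h3 h4 <;> simp_all
    apply Subtype.ext
    rw [hh2 O, hh2 O']
    ext K
    exact ⟨fun h => hc.symm.trans h, fun h => hc.trans h⟩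
  haveI : Finite X := Finite.of_injective f hf
  have h3 : Nat.card X ≤ 3 := by
    have := Nat.card_le_card_of_injective f hf
    simpa using this
  obtain ⟨H, hH⟩ := hE
  haveI : Nonempty X := ⟨⟨_, H, hH, rfl⟩⟩
  have h0 : 0 < Nat.card X := Nat.card_pos
  have : Nat.card X = 1 ∨ Nat.card X = 2 ∨ Nat.card X = 3 := by omega
  simpa using this

/-- dihedral type: an abelian subgroup of index two -/
def DT (H : Subgroup G) : Prop :=
  ∃ A : Subgroup G, A ≤ H ∧ (∀ x ∈ A, ∀ y ∈ A, x * y = y * x) ∧ 2 * Nat.card A = Nat.card H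

lemma DT_conj {H : Subgroup G} {g : G} (h : DT (conjSub g H)) : DT H := by
  obtain ⟨A, h1, h2, h3⟩ := h
  refine ⟨conjSub g⁻¹ A, ?_, ?_, ?_⟩
  · intro x hx
    have := h1 (mem_conjSub.1 hx)
    rw [mem_conjSub] at this
    simpa [mul_assoc] using this
  · intro x hx y hy
    have := h2 _ (mem_conjSub.1 hx) _ (mem_conjSub.1 hy)
    simp only [inv_inv] at this
    have h4 : g * (x * y) * g⁻¹ = g * (y * x) * g⁻¹ := by
      calc _ = g * x * g⁻¹ * (g * y * g⁻¹) := by group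
        _ = _ := this
        _ = _ := by group
    exact mul_left_cancel (mul_right_cancel h4)
  · rw [conjSub_card, h3, conjSub_card]

/-- count via subgroups containing a fixed 2-subgroup -/
lemma count2 (P : Subgroup G → Prop) (hE : ∃ H : Subgroup G, IsHallPi π H) (h2 : 2 ∈ π)
    (Q : Subgroup G) (hQ : IsPGroup 2 Q)
    (hD : ∀ H H' : Subgroup G, IsHallPi π H → IsHallPi π H' → DT H → DT H' → Cj H H')
    (hR : ∀ H H' : Subgroup G, IsHallPi π H → IsHallPi π H' → ¬ DT H → ¬ DT H' →
      Q ≤ H → Q ≤ H' → (P H ↔ P H') → Cj H H') :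
    kPi π G ∈ ({1, 2, 3} : Set ℕ) := by
  classical
  have hg : ∀ H : Subgroup G, ∃ g, IsHallPi π H → Q ≤ conjSub g H := by
    intro H
    by_cases h : IsHallPi π H
    · obtain ⟨g, hg⟩ := hall_sylow Nat.prime_two h2 hQ h
      exact ⟨g, fun _ => hg⟩
    · exact ⟨1, fun h' => absurd h' h⟩
  choose c hc using hg
  refine count DT (fun H => P (conjSub (c H) H)) hE hD ?_
  intro H H' h h' hd hd' hP
  apply Cj.of_conj (a := c H) (b := c H')
  exact hR _ _ (hall_conj _ h) (hall_conj _ h') (fun h => hd (DT_conj h)) (fun h => hd' (DT_conj h))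
    (hc H h) (hc H' h') hP
end hall
end HallSL

namespace HallSL
open Matrix

abbrev SL2 (F : Type*) [Field F] := Matrix.SpecialLinearGroup (Fin 2) F

set_option linter.unusedSectionVars false
set_option linter.style.haveILetI false
set_option linter.unusedVariables false
set_option linter.deprecated false

lemma card_relIndex {G : Type*} [Group G] {A H : Subgroup G} (hle : A ≤ H) :
    Nat.card A * A.relIndex H = Nat.card H := by
  have h2 := Subgroup.card_mul_index (A.subgroupOf H)
  rwa [Nat.card_congr (Subgroup.subgroupOfEquivOfLe hle).toEquiv] at h2

lemma half {G : Type*} [Group G] [Finite G] {A H : Subgroup G} (hle : A ≤ H)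
    (hc : 2 * Nat.card A = Nat.card H) : (∀ h ∈ H, h * h ∈ A) ∧
    (∀ a ∈ H, ∀ b ∈ H, a ∉ A → b ∉ A → a * b ∈ A) := by
  have hi : (A.subgroupOf H).index = 2 := by
    have h1 := card_relIndex hle
    unfold Subgroup.relIndex at h1
    apply Nat.eq_of_mul_eq_mul_left (Nat.card_pos (α := A))
    rw [h1, ← hc, Nat.mul_comm]
  constructor
  · intro h hh
    have := Subgroup.sq_mem_of_index_two hi ⟨h, hh⟩
    rw [Subgroup.mem_subgroupOf] at this
    simpa [pow_two] using this
  · intro a ha b hb h1 h2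
    have := Subgroup.mul_mem_iff_of_index_two hi (a := ⟨a, ha⟩) (b := ⟨b, hb⟩)
    simp only [Subgroup.mem_subgroupOf, Subgroup.coe_mul] at this
    rw [this]
    tauto

section D
variable {F : Type*} [Field F]

def w0 (F : Type*) [Field F] : SL2 F := ⟨!![0, -1; 1, -1], by simp⟩

lemma SLmul (a b : SL2 F) : (a * b).1 = a.1 * b.1 := rfl
lemma SLone : (1 : SL2 F).1 = 1 := rfl

lemma w0_cube : w0 F * w0 F * w0 F = 1 := by
  apply Subtype.ext
  rw [SLmul, SLmul, SLone]
  simp [w0, Matrix.one_fin_two]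

lemma w0_trace : (w0 F).1.trace = -1 := by simp [w0, Matrix.trace_fin_two]

lemma trace_conj (y x : SL2 F) : (y * x * y⁻¹).1.trace = x.1.trace := by
  have h : (y⁻¹ * y).1 = (1 : SL2 F).1 := by rw [inv_mul_cancel]
  rw [SLmul, SLone] at h
  rw [SLmul, SLmul]
  rw [Matrix.trace_mul_comm, ← Matrix.mul_assoc, h, one_mul]

lemma w0_ne (h20 : (2 : F) ≠ 0) (h30 : (3 : F) ≠ 0) : w0 F ≠ 1 ∧ w0 F ≠ -1 := by
  constructor
  · intro h
    have := congrArg (fun x : SL2 F => x.1 1 0) h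
    simp [w0] at this
  · intro h
    have := congrArg (fun x : SL2 F => x.1 1 0) h
    simp [w0] at this

/-- structure of a dihedral-type group containing w0 -/
lemma D_struct [Finite F] (h20 : (2 : F) ≠ 0) (h30 : (3 : F) ≠ 0) {H : Subgroup (SL2 F)}
    (hw : w0 F ∈ H) (hna : ∃ x ∈ H, ∃ y ∈ H, x * y ≠ y * x) (hD : DT H) :
    ∃ A : Subgroup (SL2 F), A ≤ H ∧ (∀ x ∈ A, w0 F * x = x * w0 F) ∧ 2 * Nat.card A = Nat.card H ∧
      ∃ y ∈ H, y * w0 F * y⁻¹ = (w0 F)⁻¹ ∧ ∀ h ∈ H, h ∈ A ∨ h * y⁻¹ ∈ A := by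
  obtain ⟨A, hle, hab, hc⟩ := hD
  obtain ⟨hsq, hmul⟩ := half hle hc
  obtain ⟨hw1, hw2⟩ := w0_ne h20 h30
  have hwA : w0 F ∈ A := by
    have : w0 F = (w0 F * w0 F) * (w0 F * w0 F) := by
      rw [← mul_assoc, w0_cube, one_mul]
    rw [this]
    exact A.mul_mem (hsq _ hw) (hsq _ hw)
  have hT : ∀ x ∈ A, w0 F * x = x * w0 F := fun x hx => hab _ hwA _ hx
  have hy : ∃ y ∈ H, y ∉ A := by
    by_contra hcon
    push Not at hcon
    obtain ⟨x, hx, y, hy, hxy⟩ := hna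
    exact hxy (hab x (hcon x hx) y (hcon y hy))
  obtain ⟨y, hyH, hyA⟩ := hy
  have hcov : ∀ h ∈ H, h ∈ A ∨ h * y⁻¹ ∈ A := by
    intro h hh
    by_cases hA : h ∈ A
    · exact Or.inl hA
    · right
      exact hmul h hh _ (H.inv_mem hyH) hA (fun h => hyA (by simpa using A.inv_mem h))
  have hyw : y * w0 F * y⁻¹ ∈ A := by
    apply hmul _ (H.mul_mem hyH hw) _ (H.inv_mem hyH)
    · intro h
      apply hyA
      have := A.mul_mem h (A.inv_mem hwA)
      simpa using this
    · intro h; exact hyA (by simpa using A.inv_mem h)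
  refine ⟨A, hle, hT, hc, y, hyH, ?_, hcov⟩
  have htr : (w0 F).1.trace ^ 2 ≠ 4 := by
    rw [w0_trace]
    intro h
    apply h30
    linear_combination -h
  rcases SL_same_trace h20 hw1 hw2 htr (hT _ hyw) (trace_conj y _) with h | h
  · exfalso
    have hyc : w0 F * y = y * w0 F := by
      rw [mul_inv_eq_iff_eq_mul] at h
      exact h.symm
    have hall : ∀ h ∈ H, w0 F * h = h * w0 F := by
      intro h hh
      rcases hcov h hh with h1 | h1
      · exact hT _ h1
      · have h2 := hT _ h1
        calc w0 F * h = w0 F * (h * y⁻¹) * y := by group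
          _ = h * y⁻¹ * (w0 F * y) := by rw [h2]; group
          _ = h * w0 F := by rw [hyc]; group
    obtain ⟨a, ha, b, hb, hn⟩ := hna
    exact hn (SL_comm_trans hw1 hw2 (hall a ha) (hall b hb))
  · exact h

/-- normalizer-type subgroup of w0 -/
def LL (F : Type*) [Field F] : Subgroup (SL2 F) where
  carrier := {g | g * w0 F * g⁻¹ = w0 F ∨ g * w0 F * g⁻¹ = (w0 F)⁻¹}
  one_mem' := by left; simp
  mul_mem' := by
    intro a b ha hb
    have h : a * b * w0 F * (a * b)⁻¹ = a * (b * w0 F * b⁻¹) * a⁻¹ := by group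
    have h' : a * (w0 F)⁻¹ * a⁻¹ = (a * w0 F * a⁻¹)⁻¹ := by group
    simp only [Set.mem_setOf_eq] at *
    rw [h]
    rcases hb with hb | hb <;> rcases ha with ha | ha <;> rw [hb] <;> simp [h', ha]
  inv_mem' := by
    intro a ha
    have h' : a * (w0 F)⁻¹ * a⁻¹ = (a * w0 F * a⁻¹)⁻¹ := by group
    simp only [Set.mem_setOf_eq] at *
    rcases ha with ha | ha
    · left; nth_rewrite 1 [← ha]; group
    · right
      rw [ha, inv_inv] at h'
      nth_rewrite 1 [← h']; group

lemma D_conj [Finite F] {π : Set ℕ} (h2 : 2 ∈ π) (h3 : 3 ∈ π) (h20 : (2 : F) ≠ 0) (h30 : (3 : F) ≠ 0)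
    (hna : ∀ H : Subgroup (SL2 F), IsHallPi π H → ∃ x ∈ H, ∃ y ∈ H, x * y ≠ y * x)
    (H1 H2 : Subgroup (SL2 F)) (hH1 : IsHallPi π H1) (hH2 : IsHallPi π H2)
    (hD1 : DT H1) (hD2 : DT H2) : Cj H1 H2 := by
  have hw3 : IsPGroup 3 (Subgroup.zpowers (w0 F)) := by
    apply IsPGroup.of_card (n := 1)
    rw [Nat.card_zpowers, pow_one]
    haveI : Fact (Nat.Prime 3) := ⟨Nat.prime_three⟩
    apply orderOf_eq_prime _ (w0_ne h20 h30).1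
    rw [pow_succ, pow_two, w0_cube]
  have key : ∀ H1 H2 : Subgroup (SL2 F), IsHallPi π H1 → IsHallPi π H2 → DT H1 → DT H2 →
      w0 F ∈ H1 → w0 F ∈ H2 → Cj H1 H2 := by
    clear hD1 hD2 hH1 hH2 H1 H2
    intro H1 H2 hH1 hH2 hD1 hD2 hw1 hw2
    obtain ⟨A1, hle1, hT1, hc1, y1, hy1, hi1, hcov1⟩ := D_struct h20 h30 hw1 (hna _ hH1) hD1
    obtain ⟨A2, hle2, hT2, hc2, y2, hy2, hi2, hcov2⟩ := D_struct h20 h30 hw2 (hna _ hH2) hD2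
    obtain ⟨hwn1, hwn2⟩ := w0_ne h20 h30
    have hTcomm : ∀ a b, w0 F * a = a * w0 F → w0 F * b = b * w0 F → a * b = b * a :=
      fun a b => SL_comm_trans hwn1 hwn2
    set T : Subgroup (SL2 F) := Subgroup.centralizer {w0 F} with hTdef
    have hmemT : ∀ x, x ∈ T ↔ w0 F * x = x * w0 F := by
      intro x
      rw [hTdef, Subgroup.mem_centralizer_singleton_iff]
      exact eq_comm
    have hTL : T ≤ LL F := by
      intro x hx
      left
      rw [← (hmemT x).1 hx, mul_inv_cancel_right]
    have hH1L : H1 ≤ LL F := by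
      intro x hx
      rcases hcov1 x hx with h | h
      · exact hTL ((hmemT x).2 (hT1 x h))
      · have h1 : x = (x * y1⁻¹) * y1 := by group
        rw [h1]
        exact (LL F).mul_mem (hTL ((hmemT _).2 (hT1 _ h))) (Or.inr hi1)
    have hA1T : A1 ≤ T := fun x hx => (hmemT x).2 (hT1 x hx)
    have hww : (w0 F)⁻¹ ≠ w0 F := by
      intro h
      have h1 : w0 F * w0 F = 1 := by nth_rewrite 1 [← h]; simp
      have := w0_cube (F := F)
      rw [h1, one_mul] at this
      exact hwn1 this
    have hTL2 : T.relIndex (LL F) = 2 := by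
      unfold Subgroup.relIndex
      rw [Subgroup.index_eq_two_iff]
      refine ⟨⟨y1, Or.inr hi1⟩, ?_⟩
      rintro ⟨b, hb⟩
      simp only [Subgroup.mem_subgroupOf, Subgroup.coe_mul, hmemT]
      have e : ∀ x : SL2 F, (w0 F * x = x * w0 F) ↔ x * w0 F * x⁻¹ = w0 F := by
        intro x; rw [mul_inv_eq_iff_eq_mul, eq_comm]
      have e2 : b * y1 * w0 F * (b * y1)⁻¹ = (b * w0 F * b⁻¹)⁻¹ := by
        calc _ = b * (y1 * w0 F * y1⁻¹) * b⁻¹ := by group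
          _ = _ := by rw [hi1]; group
      rw [e, e, e2]
      rcases hb with hb | hb
      · rw [hb]
        right
        exact ⟨rfl, hww⟩
      · rw [hb]
        left
        exact ⟨inv_inv _, hww⟩
    set m := H1.relIndex (LL F) with hm
    have hmi : m * (LL F).index = H1.index := Subgroup.relIndex_mul_index hH1L
    have hcard : Nat.card A1 * m = Nat.card T := by
      have e1 := card_relIndex hH1L
      have e2 := card_relIndex hTL
      rw [hTL2] at e2
      rw [← hm] at e1
      rw [← e1, ← hc1] at e2
      linarith
    have hmT : A1.relIndex T = m := by
      have e1 := card_relIndex hA1T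
      apply Nat.eq_of_mul_eq_mul_left (Nat.card_pos (α := A1))
      rw [e1, hcard]
    have hpow : ∀ t ∈ T, t ^ m ∈ A1 := by
      intro t ht
      have hn : (A1.subgroupOf T).Normal := by
        constructor
        rintro ⟨n, hn⟩ hnA ⟨g, hg⟩
        rw [Subgroup.mem_subgroupOf] at hnA ⊢
        simp only [Subgroup.coe_mul, InvMemClass.coe_inv] at hnA ⊢
        rwa [hTcomm g n ((hmemT _).1 hg) ((hmemT _).1 hn), mul_inv_cancel_right]
      have := Subgroup.pow_index_mem (A1.subgroupOf T) ⟨t, ht⟩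
      rw [Subgroup.mem_subgroupOf] at this
      rw [← hmT]
      exact this
    have hcop : Nat.Coprime (Nat.card H2) m :=
      (hall_coprime hH2 hH1).coprime_dvd_right ⟨_, hmi.symm⟩
    have hA21 : A2 ≤ A1 := by
      intro a ha
      have hco : m.Coprime (orderOf a) := by
        apply Nat.Coprime.symm
        exact hcop.coprime_dvd_left (Subgroup.orderOf_dvd_natCard _ (hle2 ha))
      obtain ⟨k, hk⟩ := exists_pow_eq_self_of_coprime hco
      rw [← hk]
      exact A1.pow_mem (hpow a ((hmemT a).2 (hT2 a ha))) k
    have hAc : Nat.card A2 = Nat.card A1 := by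
      have := hall_card hH1 hH2
      omega
    have hA : A2 = A1 := eq_of_le_of_card hA21 hAc
    have hmo : Odd m := by
      rw [← Nat.not_even_iff_odd, even_iff_two_dvd]
      intro h
      exact hH1.2 2 h2 Nat.prime_two (h.trans ⟨_, hmi.symm⟩)
    obtain ⟨k, hk⟩ := hmo
    have htT : y2 * y1⁻¹ ∈ T := by
      rw [hmemT, eq_comm, ← mul_inv_eq_iff_eq_mul]
      have e1 : y1⁻¹ * w0 F * y1 = (w0 F)⁻¹ := by
        have := congrArg (fun x => y1⁻¹ * x⁻¹ * y1) hi1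
        simp only [inv_inv] at this
        rw [← this]; group
      calc _ = y2 * (y1⁻¹ * w0 F * y1) * y2⁻¹ := by group
        _ = (y2 * w0 F * y2⁻¹)⁻¹ := by rw [e1]; group
        _ = _ := by rw [hi2, inv_inv]
    set t := y2 * y1⁻¹ with htd
    have hsT : (t ^ k)⁻¹ ∈ T := T.inv_mem (T.pow_mem htT k)
    have hinv : y1 * t ^ k * y1⁻¹ = (t ^ k)⁻¹ :=
      SL_invert hwn1 hwn2 hi1 ((hmemT _).1 (T.pow_mem htT k))
    have hsy : (t ^ k)⁻¹ * y1 * t ^ k ∈ H2 := by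
      have e : (t ^ k)⁻¹ * y1 * t ^ k = (t ^ m)⁻¹ * y2 := by
        have e1 : y1 * t ^ k = (t ^ k)⁻¹ * y1 := by rw [← hinv]; group
        rw [mul_assoc, e1]
        have e2 : y2 = t * y1 := by rw [htd]; group
        rw [e2, hk]
        group
      rw [e]
      apply H2.mul_mem (H2.inv_mem (hle2 _)) hy2
      rw [hA]
      exact hpow t htT
    have hfix : ∀ a ∈ A1, (t ^ k)⁻¹ * a * t ^ k = a := by
      intro a ha
      rw [hTcomm _ a ((hmemT _).1 hsT) (hT1 a ha), inv_mul_cancel_right]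
    refine ⟨(t ^ k)⁻¹, eq_of_le_of_card ?_ ?_⟩
    · intro x hx
      rw [mem_conjSub, inv_inv] at hx
      have hx' : x = (t ^ k)⁻¹ * (t ^ k * x * (t ^ k)⁻¹) * t ^ k := by group
      rw [hx']
      generalize t ^ k * x * (t ^ k)⁻¹ = u at hx
      rcases hcov1 u hx with h | h
      · rw [hfix u h]; rw [← hA] at h; exact hle2 h
      · have e : (t ^ k)⁻¹ * u * t ^ k = ((t ^ k)⁻¹ * (u * y1⁻¹) * t ^ k) * ((t ^ k)⁻¹ * y1 * t ^ k) := by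
          group
        rw [e, hfix _ h]
        rw [← hA] at h
        exact H2.mul_mem (hle2 h) hsy
    · rw [conjSub_card]; exact hall_card hH1 hH2
  obtain ⟨g1, hg1⟩ := hall_sylow Nat.prime_three h3 hw3 hH1
  obtain ⟨g2, hg2⟩ := hall_sylow Nat.prime_three h3 hw3 hH2
  apply Cj.of_conj (a := g1) (b := g2)
  have hd : ∀ g (H : Subgroup (SL2 F)), DT H → DT (conjSub g H) := by
    intro g H h
    apply DT_conj (g := g⁻¹)
    rwa [conjSub_mul, inv_mul_cancel, conjSub_one]
  exact key _ _ (hall_conj _ hH1) (hall_conj _ hH2) (hd _ _ hD1) (hd _ _ hD2)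
    (hg1 (Subgroup.mem_zpowers _)) (hg2 (Subgroup.mem_zpowers _))
end D
end HallSL

namespace HallSL
open Matrix

set_option linter.unusedSectionVars false
set_option linter.style.haveILetI false
set_option linter.unusedVariables false
set_option linter.deprecated false

section Q
variable {F : Type*} [Field F]

def sim (u v : SL2 F) : Prop := u = v ∨ u = -v

lemma sim.symm {u v : SL2 F} (h : sim u v) : sim v u := by
  rcases h with rfl | rfl
  · exact Or.inl rfl
  · right; simp

lemma sim.trans {u v w : SL2 F} (h : sim u v) (h' : sim v w) : sim u w := by
  rcases h with rfl | rfl <;> rcases h' with rfl | rfl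
  · exact Or.inl rfl
  · exact Or.inr rfl
  · exact Or.inr rfl
  · left; simp

lemma sim.conj {u v : SL2 F} (g : SL2 F) (h : sim u v) : sim (g * u * g⁻¹) (g * v * g⁻¹) := by
  rcases h with rfl | rfl
  · exact Or.inl rfl
  · right; simp

lemma sim.mul {u v u' v' : SL2 F} (h : sim u v) (h' : sim u' v') : sim (u * u') (v * v') := by
  rcases h with rfl | rfl <;> rcases h' with rfl | rfl
  · exact Or.inl rfl
  · right; simp
  · right; simp
  · left; simp

lemma sim.mem {u v : SL2 F} {H : Subgroup (SL2 F)} (hz : -1 ∈ H) (h : sim u v) (hv : v ∈ H) : u ∈ H := by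
  rcases h with rfl | rfl
  · exact hv
  · rw [← neg_one_mul]; exact H.mul_mem hz hv

/-- elements fixing i up to sign -/
def Sg (i : SL2 F) : Subgroup (SL2 F) where
  carrier := {x | sim (x * i * x⁻¹) i}
  one_mem' := by left; simp
  mul_mem' := by
    intro a b ha hb
    have h : a * b * i * (a * b)⁻¹ = a * (b * i * b⁻¹) * a⁻¹ := by group
    show sim _ _
    rw [h]
    exact (sim.conj a hb).trans ha
  inv_mem' := by
    intro a ha
    have := (sim.conj a⁻¹ ha).symm
    show sim _ _
    convert this using 1
    group

lemma mem_Sg {i x : SL2 F} : x ∈ Sg i ↔ sim (x * i * x⁻¹) i := Iff.rfl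

lemma Sg_conj {i x g : SL2 F} (h : x ∈ Sg i) : g * x * g⁻¹ ∈ Sg (g * i * g⁻¹) := by
  rw [mem_Sg] at *
  convert sim.conj g h using 1
  group

lemma Sg_sim {i j x : SL2 F} (hs : sim i j) (h : x ∈ Sg i) : x ∈ Sg j := by
  rw [mem_Sg] at *
  exact ((sim.conj x hs).symm.trans h).trans hs

lemma Sg_mul {i j x : SL2 F} (h : x ∈ Sg i) (h' : x ∈ Sg j) : x ∈ Sg (i * j) := by
  rw [mem_Sg] at *
  convert h.mul h' using 1
  group

lemma neg_mem_Sg (i : SL2 F) : -1 ∈ Sg i := by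
  rw [mem_Sg]; left; simp

variable (a b : F) (hab : a * a + b * b = -1)

def qI (F : Type*) [Field F] : SL2 F := ⟨!![0, 1; -1, 0], by simp⟩
def qJ : SL2 F := ⟨!![a, b; b, -a], by rw [Matrix.det_fin_two_of]; linear_combination -hab⟩
def qw (h20 : (2 : F) ≠ 0) : SL2 F := ⟨!![-(1 + a + b) / 2, -(1 + b - a) / 2; -(b - a - 1) / 2, -(1 - a - b) / 2], by
  rw [Matrix.det_fin_two_of]; field_simp; linear_combination (-2) * hab⟩

lemma SLneg (x : SL2 F) : (-x).1 = -x.1 := rfl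

lemma II : qI F * qI F = -1 := by
  apply Subtype.ext
  rw [SLmul, SLneg, SLone]
  simp [qI, Matrix.one_fin_two]

lemma JJ : qJ a b hab * qJ a b hab = -1 := by
  apply Subtype.ext
  rw [SLmul, SLneg, SLone]
  ext i j
  fin_cases i <;> fin_cases j <;> simp [qJ, Matrix.mul_apply, Fin.sum_univ_two] <;>
    first | linear_combination hab | ring

lemma JI : qJ a b hab * qI F = -(qI F * qJ a b hab) := by
  apply Subtype.ext
  rw [SLmul, SLneg, SLmul]
  ext i j
  fin_cases i <;> fin_cases j <;> simp [qJ, qI, Matrix.mul_apply, Fin.sum_univ_two]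

lemma wI (h20 : (2 : F) ≠ 0) : qw a b hab h20 * qI F = qJ a b hab * qw a b hab h20 := by
  apply Subtype.ext
  rw [SLmul, SLmul]
  ext i j
  fin_cases i <;> fin_cases j <;> simp [qJ, qI, qw, Matrix.mul_apply, Fin.sum_univ_two] <;> field_simp <;> 
    first | linear_combination hab | linear_combination -hab

lemma wJ (h20 : (2 : F) ≠ 0) : qw a b hab h20 * qJ a b hab = qI F * qJ a b hab * qw a b hab h20 := by
  apply Subtype.ext
  rw [SLmul, SLmul, SLmul]
  ext i j
  fin_cases i <;> fin_cases j <;> simp [qJ, qI, qw, Matrix.mul_apply, Fin.sum_univ_two] <;> field_simp <;> 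
    ring

lemma w_cube (h20 : (2 : F) ≠ 0) : qw a b hab h20 * qw a b hab h20 = (qw a b hab h20)⁻¹ := by
  apply Subtype.ext
  rw [SLmul, SpecialLinearGroup.SL2_inv_expl]
  ext i j
  fin_cases i <;> fin_cases j <;> simp [qw, Matrix.mul_apply, Fin.sum_univ_two] <;> field_simp <;> 
    first | linear_combination 2 * hab | linear_combination -2 * hab | ring

lemma one_ne_neg (h20 : (2 : F) ≠ 0) : (1 : SL2 F) ≠ -1 := by
  intro h
  have := congrArg (fun x : SL2 F => x.1 0 0) h
  simp at this
  apply h20; linear_combination this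

lemma neg_ne (h20 : (2 : F) ≠ 0) (x : SL2 F) : x ≠ -x := by
  intro h
  apply one_ne_neg h20
  have := congrArg (fun y => y * x⁻¹) h
  simpa using this

def Q8 : Subgroup (SL2 F) := Sg (qI F) ⊓ Sg (qJ a b hab)


lemma sq_neg_ne (h20 : (2 : F) ≠ 0) {x : SL2 F} (h : x * x = -1) : x ≠ 1 ∧ x ≠ -1 := by
  constructor
  · rintro rfl; exact one_ne_neg h20 (by simpa using h)
  · rintro rfl; exact one_ne_neg h20 (by simpa using h)

lemma KK : (qI F * qJ a b hab) * (qI F * qJ a b hab) = -1 := by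
  calc _ = qI F * (qJ a b hab * qI F) * qJ a b hab := by group
    _ = -(qI F * qI F * (qJ a b hab * qJ a b hab)) := by rw [JI]; simp [mul_assoc]
    _ = -1 := by rw [II, JJ]; simp

lemma sim_div {x y : SL2 F} (hy : y * y = -1) (h : sim (x * y) 1) : sim x y := by
  have h1 : x * y * y = -x := by rw [mul_assoc, hy]; simp
  have := h.mul (Or.inl rfl : sim y y)
  rw [h1, one_mul] at this
  exact sim.trans (Or.inr (by simp)) this

lemma IJ_ne (h20 : (2 : F) ≠ 0) : qI F * qJ a b hab ≠ qJ a b hab * qI F := by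
  rw [JI]; exact neg_ne h20 _

lemma not_sim_IJ (h20 : (2 : F) ≠ 0) : ¬ sim (qI F) (qJ a b hab) := by
  rintro (h | h)
  · apply IJ_ne a b hab h20; rw [h]
  · apply IJ_ne a b hab h20; rw [h]; simp

lemma comm_of_conj {x i : SL2 F} (h : x * i * x⁻¹ = i) : x * i = i * x := by
  rwa [mul_inv_eq_iff_eq_mul] at h

lemma acomm_of_conj {x i : SL2 F} (h : x * i * x⁻¹ = -i) : x * i = -(i * x) := by
  rw [mul_inv_eq_iff_eq_mul] at h; rw [h]; simp

lemma Q8_core (h20 : (2 : F) ≠ 0) {x : SL2 F} (h1 : x * qI F = qI F * x)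
    (h2 : x * qJ a b hab = qJ a b hab * x) : sim x 1 := by
  by_contra h
  unfold sim at h
  push Not at h
  exact IJ_ne a b hab h20 (SL_comm_trans h.1 h.2 h1 h2)

lemma mul_comm_cc {x y i : SL2 F} (h1 : x * i = i * x) (h2 : y * i = i * y) :
    x * y * i = i * (x * y) := by
  rw [mul_assoc, h2, ← mul_assoc, h1, mul_assoc]

lemma mul_comm_aa {x y i : SL2 F} (h1 : x * i = -(i * x)) (h2 : y * i = -(i * y)) :
    x * y * i = i * (x * y) := by
  rw [mul_assoc, h2, mul_neg, ← mul_assoc, h1, neg_mul, neg_neg, mul_assoc]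

lemma mul_comm_ca {x y i : SL2 F} (h1 : x * i = i * x) (h2 : y * i = -(i * y)) :
    x * y * i = -(i * (x * y)) := by
  rw [mul_assoc, h2, mul_neg, ← mul_assoc, h1, mul_assoc]

lemma mul_comm_ac {x y i : SL2 F} (h1 : x * i = -(i * x)) (h2 : y * i = i * y) :
    x * y * i = -(i * (x * y)) := by
  rw [mul_assoc, h2, ← mul_assoc, h1, neg_mul, mul_assoc]

lemma IJ' : qI F * qJ a b hab = -(qJ a b hab * qI F) := by rw [JI, neg_neg]

lemma Q8_exh (h20 : (2 : F) ≠ 0) {x : SL2 F} (hx : x ∈ Q8 a b hab) :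
    sim x 1 ∨ sim x (qI F) ∨ sim x (qJ a b hab) ∨ sim x (qI F * qJ a b hab) := by
  obtain ⟨hi, hj⟩ := hx
  rcases hi with hi | hi <;> rcases hj with hj | hj
  · left
    exact Q8_core a b hab h20 (comm_of_conj hi) (comm_of_conj hj)
  · right; left
    refine sim_div II (Q8_core a b hab h20 (mul_comm_cc (comm_of_conj hi) rfl) ?_)
    exact mul_comm_aa (acomm_of_conj hj) (IJ' a b hab)
  · right; right; left
    refine sim_div (JJ a b hab) (Q8_core a b hab h20 ?_ (mul_comm_cc (comm_of_conj hj) rfl))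
    exact mul_comm_aa (acomm_of_conj hi) (JI a b hab)
  · right; right; right
    refine sim_div (KK a b hab) (Q8_core a b hab h20 ?_ ?_)
    · exact mul_comm_aa (acomm_of_conj hi) (mul_comm_ca rfl (JI a b hab))
    · exact mul_comm_aa (acomm_of_conj hj) (mul_comm_ac (IJ' a b hab) rfl)

lemma conj_of_comm {x i : SL2 F} (h : x * i = i * x) : sim (x * i * x⁻¹) i := by
  left; rw [h, mul_inv_cancel_right]

lemma conj_of_acomm {x i : SL2 F} (h : x * i = -(i * x)) : sim (x * i * x⁻¹) i := by
  right; rw [h, neg_mul, mul_inv_cancel_right]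

lemma I_mem : qI F ∈ Q8 a b hab := ⟨conj_of_comm rfl, conj_of_acomm (IJ' a b hab)⟩
lemma J_mem : qJ a b hab ∈ Q8 a b hab := ⟨conj_of_acomm (JI a b hab), conj_of_comm rfl⟩
lemma neg_mem : -1 ∈ Q8 a b hab := ⟨neg_mem_Sg _, neg_mem_Sg _⟩

lemma Q8_pgroup (h20 : (2 : F) ≠ 0) : IsPGroup 2 (Q8 a b hab) := by
  rintro ⟨x, hx⟩
  refine ⟨2, ?_⟩
  apply Subtype.ext
  show x ^ 4 = 1
  have e : x ^ 4 = (x * x) * (x * x) := by simp only [pow_succ, pow_zero, one_mul, mul_assoc]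
  rw [e]
  rcases Q8_exh a b hab h20 hx with (rfl | rfl) | (rfl | rfl) | (rfl | rfl) | (rfl | rfl) <;>
    simp [II, JJ, KK]

lemma order_four (h20 : (2 : F) ≠ 0) {x : SL2 F} (h : x * x = -1) : orderOf x = 4 := by
  have : Fact (Nat.Prime 2) := ⟨Nat.prime_two⟩
  have := orderOf_eq_prime_pow (x := x) (p := 2) (n := 1) (by
    rw [pow_one, pow_two, h]; exact (one_ne_neg h20).symm) (by
    have e : x ^ (2 ^ (1 + 1)) = (x * x) * (x * x) := by
      norm_num; simp only [pow_succ, pow_zero, one_mul, mul_assoc]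
    rw [e, h]; simp)
  simpa using this

lemma eight_dvd [Finite F] (h20 : (2 : F) ≠ 0) {H : Subgroup (SL2 F)} (h : Q8 a b hab ≤ H) : 8 ∣ Nat.card H := by
  refine dvd_trans ?_ (Subgroup.card_dvd_of_le h)
  have : Fact (Nat.Prime 2) := ⟨Nat.prime_two⟩
  obtain ⟨n, hn⟩ := IsPGroup.iff_card.1 (Q8_pgroup a b hab h20)
  have h4 : Nat.card (Subgroup.zpowers (qI F)) = 4 := by
    rw [Nat.card_zpowers, order_four h20 II]
  have hle : Subgroup.zpowers (qI F) ≤ Q8 a b hab := by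
    rw [Subgroup.zpowers_le]; exact I_mem a b hab
  have hne : Nat.card (Q8 a b hab) ≠ 4 := by
    intro h
    have := eq_of_le_of_card hle (h4.trans h.symm)
    have hJ := J_mem a b hab
    rw [← this] at hJ
    obtain ⟨k, hk⟩ := Subgroup.mem_zpowers_iff.1 hJ
    apply IJ_ne a b hab h20
    rw [← hk]
    exact (Commute.self_zpow (qI F) k)
  have hd := Subgroup.card_dvd_of_le hle
  rw [h4, hn] at hd
  rw [hn] at hne ⊢
  have h3 : 3 ≤ n := by
    by_contra hlt
    interval_cases n
    · norm_num at hd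
    · norm_num at hd
    · norm_num at hne
  exact pow_dvd_pow 2 h3

lemma w_mem_norm (h20 : (2 : F) ≠ 0) {x : SL2 F} (hx : x ∈ Q8 a b hab) :
    qw a b hab h20 * x * (qw a b hab h20)⁻¹ ∈ Q8 a b hab := by
  have e1 : qw a b hab h20 * qI F * (qw a b hab h20)⁻¹ = qJ a b hab := by
    rw [wI, mul_inv_cancel_right]
  have e2 : qw a b hab h20 * qJ a b hab * (qw a b hab h20)⁻¹ = qI F * qJ a b hab := by
    rw [wJ, mul_inv_cancel_right]
  have e3 : qw a b hab h20 * (qI F * qJ a b hab) * (qw a b hab h20)⁻¹ = qI F := by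
    calc _ = (qw a b hab h20 * qI F * (qw a b hab h20)⁻¹) * (qw a b hab h20 * qJ a b hab * (qw a b hab h20)⁻¹) := by group
      _ = qJ a b hab * (qI F * qJ a b hab) := by rw [e1, e2]
      _ = qI F := by rw [← mul_assoc, JI, neg_mul, mul_assoc, JJ]; simp
  constructor
  · have := Sg_conj (g := qw a b hab h20) (Sg_mul hx.1 hx.2)
    rwa [e3] at this
  · have := Sg_conj (g := qw a b hab h20) hx.1
    rwa [e1] at this

/-- if T4 holds then w is in H -/
lemma w_mem [Finite F] (h20 : (2 : F) ≠ 0) {H : Subgroup (SL2 F)} (hQ : Q8 a b hab ≤ H) (hz : -1 ∈ H)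
    (hT : T4 H ⟨-1, hz⟩) : qw a b hab h20 ∈ H := by
  set I := qI F with hI
  set J := qJ a b hab with hJ
  set w := qw a b hab h20 with hw
  have hIH : I ∈ H := hQ (I_mem a b hab)
  have hJH : J ∈ H := hQ (J_mem a b hab)
  have hKH : I * J ∈ H := H.mul_mem hIH hJH
  have hcent : ∀ y ∈ H, y * y = -1 → ∀ x ∈ H, x * y = y * x → ∃ k : ℤ, y ^ k = x := by
    intro y hy hyy x hx hc
    have h4 := hT.1 ⟨y, hy⟩ (Subtype.ext hyy)
    have hle : Subgroup.zpowers (⟨y, hy⟩ : H) ≤ Subgroup.centralizer {⟨y, hy⟩} := by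
      rw [Subgroup.zpowers_le, Subgroup.mem_centralizer_singleton_iff]
    have hz4 : Nat.card (Subgroup.zpowers (⟨y, hy⟩ : H)) = 4 := by
      rw [Nat.card_zpowers, Subgroup.orderOf_mk, order_four h20 hyy]
    have he := eq_of_le_of_card hle (hz4.trans h4.symm)
    have hm : (⟨x, hx⟩ : H) ∈ Subgroup.centralizer {(⟨y, hy⟩ : H)} := by
      rw [Subgroup.mem_centralizer_singleton_iff]
      exact Subtype.ext hc
    rw [← he] at hm
    obtain ⟨k, hk⟩ := Subgroup.mem_zpowers_iff.1 hm
    refine ⟨k, ?_⟩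
    have := congrArg Subtype.val hk
    simpa using this
  have hSI : ∀ x ∈ H, x ∈ Sg I → x ∈ Q8 a b hab := by
    intro x hx hs
    rcases hs with hs | hs
    · obtain ⟨k, rfl⟩ := hcent I hIH II x hx (comm_of_conj hs)
      exact (Q8 a b hab).zpow_mem (I_mem a b hab) k
    · obtain ⟨k, hk⟩ := hcent I hIH II (x * J) (H.mul_mem hx hJH) (mul_comm_aa (acomm_of_conj hs) (JI a b hab))
      have : x = I ^ k * J⁻¹ := by rw [hk]; group
      rw [this]
      exact (Q8 a b hab).mul_mem ((Q8 a b hab).zpow_mem (I_mem a b hab) k) ((Q8 a b hab).inv_mem (J_mem a b hab))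
  have hSJ : ∀ x ∈ H, x ∈ Sg J → x ∈ Q8 a b hab := by
    intro x hx hs
    rcases hs with hs | hs
    · obtain ⟨k, rfl⟩ := hcent J hJH (JJ a b hab) x hx (comm_of_conj hs)
      exact (Q8 a b hab).zpow_mem (J_mem a b hab) k
    · obtain ⟨k, hk⟩ := hcent J hJH (JJ a b hab) (x * I) (H.mul_mem hx hIH) (mul_comm_aa (acomm_of_conj hs) (IJ' a b hab))
      have : x = J ^ k * I⁻¹ := by rw [hk]; group
      rw [this]
      exact (Q8 a b hab).mul_mem ((Q8 a b hab).zpow_mem (J_mem a b hab) k) ((Q8 a b hab).inv_mem (I_mem a b hab))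
  have hSK : ∀ x ∈ H, x ∈ Sg (I * J) → x ∈ Q8 a b hab := by
    intro x hx hs
    rcases hs with hs | hs
    · obtain ⟨k, rfl⟩ := hcent (I * J) hKH (KK a b hab) x hx (comm_of_conj hs)
      exact (Q8 a b hab).zpow_mem ((Q8 a b hab).mul_mem (I_mem a b hab) (J_mem a b hab)) k
    · obtain ⟨k, hk⟩ := hcent (I * J) hKH (KK a b hab) (x * I) (H.mul_mem hx hIH) (mul_comm_aa (acomm_of_conj hs) (by
        rw [mul_comm_ca rfl (JI a b hab), neg_neg]))
      have : x = (I * J) ^ k * I⁻¹ := by rw [hk]; group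
      rw [this]
      exact (Q8 a b hab).mul_mem ((Q8 a b hab).zpow_mem ((Q8 a b hab).mul_mem (I_mem a b hab) (J_mem a b hab)) k) ((Q8 a b hab).inv_mem (I_mem a b hab))
  have hconj : ∀ x ∈ H, ∀ y ∈ H, x * x = -1 → y * y = -1 → ∃ h ∈ H, sim (h * x * h⁻¹) y := by
    intro x hx y hy hxx hyy
    obtain ⟨⟨h, hh⟩, h1⟩ := hT.2 ⟨x, hx⟩ ⟨y, hy⟩ (Subtype.ext hxx) (Subtype.ext hyy)
    refine ⟨h, hh, ?_⟩
    rcases h1 with h1 | h1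
    · left; exact congrArg Subtype.val h1
    · right
      have e : h * x * h⁻¹ = y⁻¹ := congrArg Subtype.val h1
      rw [e, inv_eq_iff_mul_eq_one]
      simp [hyy]
  have e1 : w * I * w⁻¹ = J := by rw [hw, hI, wI, mul_inv_cancel_right]
  have e2 : w * J * w⁻¹ = I * J := by rw [hw, hJ, wJ, mul_inv_cancel_right]
  have e3 : w * (I * J) * w⁻¹ = I := by
    calc _ = (w * I * w⁻¹) * (w * J * w⁻¹) := by group
      _ = J * (I * J) := by rw [e1, e2]
      _ = I := by rw [← mul_assoc, JI, neg_mul, mul_assoc, JJ]; simp [hI]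
  have hcan : ∀ g u v : SL2 F, sim (g * u * g⁻¹) (g * v * g⁻¹) → sim u v := by
    intro g u v h
    have := sim.conj g⁻¹ h
    have e : ∀ u, g⁻¹ * (g * u * g⁻¹) * g⁻¹⁻¹ = u := by intro u; group
    rwa [e, e] at this
  have hn1 : ∀ u : SL2 F, u * u = -1 → ¬ sim u 1 := by
    intro u hu h
    rcases h with h | h
    · exact (sq_neg_ne h20 hu).1 h
    · exact (sq_neg_ne h20 hu).2 h
  have hc1 : ∀ g u : SL2 F, sim (g * u * g⁻¹) 1 → sim u 1 := by
    intro g u h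
    apply hcan g
    simpa using h
  have hfin : ∀ g ∈ H, sim (g * I * g⁻¹) J → sim (g * J * g⁻¹) (I * J) → w ∈ H := by
    intro g hg h1 h2
    have hq : w⁻¹ * g ∈ Q8 a b hab := by
      constructor
      · show sim _ _
        apply hcan w
        have e : w * (w⁻¹ * g * I * (w⁻¹ * g)⁻¹) * w⁻¹ = g * I * g⁻¹ := by group
        rw [← hI, e, e1]; exact h1
      · show sim _ _
        apply hcan w
        have e : w * (w⁻¹ * g * J * (w⁻¹ * g)⁻¹) * w⁻¹ = g * J * g⁻¹ := by group
        rw [← hJ, e, e2]; exact h2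
    have e : w = g * (w⁻¹ * g)⁻¹ := by group
    rw [e]
    exact H.mul_mem hg (H.inv_mem (hQ hq))
  have hJSI : J ∈ Sg I := (J_mem a b hab).1
  have hISJ : I ∈ Sg J := (I_mem a b hab).2
  have hKSJ : I * J ∈ Sg J := (Sg J).mul_mem hISJ (J_mem a b hab).2
  have hcm : ∀ g u v : SL2 F, g * (u * v) * g⁻¹ = (g * u * g⁻¹) * (g * v * g⁻¹) := by
    intro g u v; group
  have hJK : sim (J * (I * J)) I := by
    left
    rw [← mul_assoc, JI, neg_mul, mul_assoc, JJ]; simp [hI]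
  have hKI : sim (I * J * I) J := by
    left
    rw [mul_assoc, JI, mul_neg, ← mul_assoc, II]; simp [hJ]
  have hKJ : sim (I * J * J) I := by
    right
    rw [mul_assoc, JJ]; simp
  obtain ⟨h, hh, hs⟩ := hconj I hIH J hJH II (JJ a b hab)
  have hx : h * J * h⁻¹ ∈ Q8 a b hab :=
    hSJ _ (H.mul_mem (H.mul_mem hh hJH) (H.inv_mem hh)) (Sg_sim hs (Sg_conj hJSI))
  rcases Q8_exh a b hab h20 hx with hx | hx | hx | hx
  · exact absurd (hc1 _ _ hx) (hn1 _ (JJ a b hab))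
  · obtain ⟨k, hk, ks⟩ := hconj J hJH (I * J) hKH (JJ a b hab) (KK a b hab)
    have hy : k * (I * J) * k⁻¹ ∈ Q8 a b hab :=
      hSK _ (H.mul_mem (H.mul_mem hk hKH) (H.inv_mem hk)) (Sg_sim ks (Sg_conj hKSJ))
    rcases Q8_exh a b hab h20 hy with hy | hy | hy | hy
    · exact absurd (hc1 _ _ hy) (hn1 _ (KK a b hab))
    · refine hfin k hk ?_ ks
      have h1 : sim (k * I * k⁻¹) (k * (J * (I * J)) * k⁻¹) := sim.conj k hJK.symm
      rw [hcm] at h1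
      exact (h1.trans (ks.mul hy)).trans hKI
    · have h1 : sim (k * I * k⁻¹) (k * (J * (I * J)) * k⁻¹) := sim.conj k hJK.symm
      rw [hcm] at h1
      have hkI : sim (k * I * k⁻¹) I := (h1.trans (ks.mul hy)).trans hKJ
      have hq : w * (k * h) ∈ Q8 a b hab := by
        constructor
        · show sim _ _
          have e : w * (k * h) * I * (w * (k * h))⁻¹ = w * (k * (h * I * h⁻¹) * k⁻¹) * w⁻¹ := by group
          rw [← hI, e]
          have := sim.conj w ((sim.conj k hs).trans ks)
          rwa [e3] at this
        · show sim _ _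
          have e : w * (k * h) * J * (w * (k * h))⁻¹ = w * (k * (h * J * h⁻¹) * k⁻¹) * w⁻¹ := by group
          rw [← hJ, e]
          have := sim.conj w ((sim.conj k hx).trans hkI)
          rwa [e1] at this
      have e : w = (w * (k * h)) * (k * h)⁻¹ := by group
      rw [e]
      exact H.mul_mem (hQ hq) (H.inv_mem (H.mul_mem hk hh))
    · exfalso
      have := hcan k _ _ (hy.trans ks.symm)
      have h1 := sim.mul this (Or.inl rfl : sim J⁻¹ J⁻¹)
      rw [mul_inv_cancel_right, mul_inv_cancel] at h1
      exact hn1 _ II h1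
  · exact absurd (hcan h _ _ (hx.trans hs.symm)).symm (not_sim_IJ a b hab h20)
  · exact hfin h hh hs hx
end Q
end HallSL

namespace HallSL
open Matrix

set_option linter.unusedSectionVars false
set_option linter.style.haveILetI false
set_option linter.unusedVariables false
set_option linter.deprecated false

section C
variable {F : Type*} [Field F]

lemma smul_ns {M : M2 F} (hM : ∀ c : F, M ≠ c • 1) {c d : F} (h : c • M = d • 1) : c = 0 := by
  by_contra hc
  apply hM (c⁻¹ * d)
  rw [mul_smul, ← h, smul_smul, inv_mul_cancel₀ hc, one_smul]

lemma sim_one_val {x : SL2 F} (h : x = 1 ∨ x = -1) : ∃ d : F, x.1 = d • 1 := by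
  rcases h with rfl | rfl
  · exact ⟨1, by rw [SLone, one_smul]⟩
  · exact ⟨-1, by rw [SLneg, SLone, neg_smul, one_smul]⟩

lemma trace_vals (h20 : (2 : F) ≠ 0) {g : SL2 F} (h1 : g ≠ 1) (h2 : g ≠ -1)
    (h : g ^ 4 = 1 ∨ g ^ 6 = 1 ∨ g ^ 10 = 1) (t : F) (ht : g.1.trace = t) :
    t = 0 ∨ t ^ 2 = 1 ∨ t ^ 2 = t + 1 ∨ t ^ 2 = 1 - t := by
  have hns := nonscalar_SL h1 h2
  have e2 : g.1 * g.1 = t • g.1 - (1 : F) • (1 : M2 F) := by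
    have := cayley g.1
    rwa [g.2, ht] at this
  have e3 : g.1 * g.1 * g.1 = (t ^ 2 - 1) • g.1 - t • 1 := by
    rw [e2, sub_mul, smul_mul_assoc, e2, smul_mul_assoc, one_mul]
    module
  have e5 : g.1 * g.1 * g.1 * (g.1 * g.1) = (t ^ 4 - 3 * t ^ 2 + 1) • g.1 - (t ^ 3 - 2 * t) • 1 := by
    rw [e3, e2, sub_mul, mul_sub, mul_sub, smul_mul_smul_comm, e2]
    simp only [smul_mul_smul_comm, one_mul, mul_one]
    module
  rcases h with h | h | h
  · left
    have hs : (g * g) * (g * g) = 1 := by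
      rw [← h]; simp only [pow_succ, pow_zero, one_mul, mul_assoc]
    obtain ⟨d, hd⟩ := sim_one_val (SL_sq_one h20 hs)
    rw [SLmul, e2] at hd
    exact smul_ns hns (c := t) (d := d + 1) (by rw [add_smul d, ← hd]; module)
  · right; left
    have hs : (g * g * g) * (g * g * g) = 1 := by
      rw [← h]; simp only [pow_succ, pow_zero, one_mul, mul_assoc]
    obtain ⟨d, hd⟩ := sim_one_val (SL_sq_one h20 hs)
    rw [SLmul, SLmul, e3] at hd
    have := smul_ns hns (c := t ^ 2 - 1) (d := d + t) (by rw [add_smul d, ← hd]; module)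
    linear_combination this
  · right; right
    have hs : (g * g * g * (g * g)) * (g * g * g * (g * g)) = 1 := by
      rw [← h]; simp only [pow_succ, pow_zero, one_mul, mul_assoc]
    obtain ⟨d, hd⟩ := sim_one_val (SL_sq_one h20 hs)
    have e5' : (g * g * g * (g * g)).1 = g.1 * g.1 * g.1 * (g.1 * g.1) := rfl
    rw [e5', e5] at hd
    have := smul_ns hns (c := t ^ 4 - 3 * t ^ 2 + 1) (d := d + (t ^ 3 - 2 * t)) (by rw [add_smul d, ← hd]; module)
    have h' : (t ^ 2 - t - 1) * (t ^ 2 + t - 1) = 0 := by linear_combination this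
    rcases mul_eq_zero.1 h' with h' | h'
    · left; linear_combination h'
    · right; linear_combination h'

def PT (t : F) : Prop := t = 2 ∨ t = -2 ∨ t = 0 ∨ t = 1 ∨ t = -1 ∨ t ^ 2 = t + 1 ∨ t ^ 2 = 1 - t

lemma trace_PT (h20 : (2 : F) ≠ 0) {g : SL2 F} (h : g ≠ 1 → g ≠ -1 → g ^ 4 = 1 ∨ g ^ 6 = 1 ∨ g ^ 10 = 1) :
    PT g.1.trace := by
  unfold PT
  by_cases h1 : g = 1
  · left; rw [h1, SLone, trace_one]; simp
  by_cases h2 : g = -1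
  · right; left; rw [h2, SLneg, SLone, trace_neg, trace_one]; simp
  rcases trace_vals h20 h1 h2 (h h1 h2) _ rfl with h | h | h | h
  · tauto
  · rcases (sq_eq_one_iff.1 h) with h | h <;> tauto
  · tauto
  · tauto

lemma field_lem (h20 : (2 : F) ≠ 0) (h30 : (3 : F) ≠ 0) (h50 : (5 : F) ≠ 0) {B C D : F}
    (hs : B + C + D = 0) (hq : B ^ 2 + C ^ 2 + D ^ 2 = 4) (hB : PT B) (hC : PT C) :
    (B = 1 ∨ B = -1) ∨ (C = 1 ∨ C = -1) ∨ (D = 1 ∨ D = -1) := by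
  have hD : D = -B - C := by linear_combination hs
  subst hD
  have hBC : B ^ 2 + B * C + C ^ 2 = 2 := by
    apply mul_left_cancel₀ h20; linear_combination hq
  have h10 : (1 : F) ≠ 0 := one_ne_zero
  have neg_case : ∀ B C : F, B ^ 2 + B * C + C ^ 2 = 2 → B = 2 → PT C → False := by
    rintro B C h rfl (h' | h' | h' | h' | h' | h' | h')
    · subst h'; exact mul_ne_zero h20 h50 (by linear_combination h)
    · subst h'; exact h20 (by linear_combination h)
    · subst h'; exact h20 (by linear_combination h)
    · subst h'; exact h50 (by linear_combination h)
    · subst h'; exact h10 (by linear_combination h)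
    · have : C = -1 := by
        apply mul_left_cancel₀ h30; linear_combination h - h'
      subst this; exact h10 (by linear_combination h)
    · have : C = -3 := by linear_combination h - h'
      subst this; exact h50 (by linear_combination h)
  have PTneg : ∀ t : F, PT t → PT (-t) := by
    rintro t (h' | h' | h' | h' | h' | h' | h') <;> unfold PT
    · subst h'; tauto
    · subst h'; simp
    · subst h'; simp
    · subst h'; tauto
    · subst h'; simp
    · right; right; right; right; right; right; linear_combination h'
    · right; right; right; right; right; left; linear_combination h'
  rcases hB with h | h | h | h | h | h | h
  · exact (neg_case B C hBC h hC).elim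
  · exact (neg_case (-B) (-C) (by linear_combination hBC) (by rw [h]; ring) (PTneg _ hC)).elim
  · subst h
    right; left
    have h2 : C ^ 2 = 2 := by linear_combination hBC
    rcases hC with h | h | h | h | h | h | h
    · subst h; exact absurd (show (2 : F) = 0 by linear_combination h2) h20
    · subst h; exact absurd (show (2 : F) = 0 by linear_combination h2) h20
    · subst h; exact absurd (show (2 : F) = 0 by linear_combination -h2) h20
    · tauto
    · tauto
    · left; linear_combination h2 - h
    · right; linear_combination h - h2
  · tauto
  · tauto
  · have : (C + 1) * (C + B - 1) = 0 := by linear_combination hBC - h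
    rcases mul_eq_zero.1 this with h' | h'
    · right; left; right; linear_combination h'
    · right; right; right; linear_combination -h'
  · have : (C - 1) * (C + B + 1) = 0 := by linear_combination hBC - h
    rcases mul_eq_zero.1 this with h' | h'
    · right; left; left; linear_combination h'
    · right; right; left; linear_combination -h'

variable (a b : F) (hab : a * a + b * b = -1)

lemma trI (x : SL2 F) : (x * qI F).1.trace = x.1 1 0 - x.1 0 1 := by
  rw [SLmul]; simp [qI, Matrix.trace_fin_two, Matrix.mul_apply, Fin.sum_univ_two]; ring

lemma trJ (x : SL2 F) : (x * qJ a b hab).1.trace = a * (x.1 0 0 - x.1 1 1) + b * (x.1 1 0 + x.1 0 1) := by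
  rw [SLmul]; simp [qJ, Matrix.trace_fin_two, Matrix.mul_apply, Fin.sum_univ_two]; ring

lemma trK (x : SL2 F) : (x * (qI F * qJ a b hab)).1.trace = b * (x.1 0 0 - x.1 1 1) - a * (x.1 1 0 + x.1 0 1) := by
  rw [SLmul, SLmul]; simp [qI, qJ, Matrix.trace_fin_two, Matrix.mul_apply, Fin.sum_univ_two]; ring

lemma tr_w (h20 : (2 : F) ≠ 0) (x : SL2 F) : 2 * (x * qw a b hab h20).1.trace + (x.1.trace + (x * qI F).1.trace +
    (x * qJ a b hab).1.trace + (x * (qI F * qJ a b hab)).1.trace) = 0 := by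
  rw [trI, trJ, trK, SLmul]
  simp [qw, Matrix.trace_fin_two, Matrix.mul_apply, Fin.sum_univ_two]
  field_simp
  ring

lemma tr_sq {x : SL2 F} (hx : x.1.trace = 0) : (x * qI F).1.trace ^ 2 +
    (x * qJ a b hab).1.trace ^ 2 + (x * (qI F * qJ a b hab)).1.trace ^ 2 = 4 := by
  rw [trI, trJ, trK]
  have hd := x.2
  rw [Matrix.trace_fin_two] at hx
  rw [Matrix.det_fin_two] at hd
  have h11 : x.1 1 1 = - x.1 0 0 := by linear_combination hx
  rw [h11] at hd ⊢
  linear_combination (4 * (x.1 0 0) ^ 2 + (x.1 1 0 + x.1 0 1) ^ 2) * hab + 4 * hd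

lemma tr_det (h20 : (2 : F) ≠ 0) {x y : SL2 F} (h0 : x.1.trace = 0) (h0' : y.1.trace = 0)
    (hI : (x * qI F).1.trace = (y * qI F).1.trace)
    (hJ : (x * qJ a b hab).1.trace = (y * qJ a b hab).1.trace)
    (hK : (x * (qI F * qJ a b hab)).1.trace = (y * (qI F * qJ a b hab)).1.trace) : x = y := by
  rw [trI, trI] at hI
  rw [trJ, trJ] at hJ
  rw [trK, trK] at hK
  rw [Matrix.trace_fin_two] at h0 h0'
  apply Subtype.ext
  have e1 : x.1 1 0 + x.1 0 1 = y.1 1 0 + y.1 0 1 := by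
    linear_combination -b * hJ + a * hK - (x.1 1 0 + x.1 0 1 - y.1 1 0 - y.1 0 1) * (- hab)
  have e2 : x.1 0 0 - x.1 1 1 = y.1 0 0 - y.1 1 1 := by
    linear_combination -a * hJ - b * hK + (x.1 0 0 - x.1 1 1 - (y.1 0 0 - y.1 1 1)) * hab
  apply ext2 <;> apply mul_left_cancel₀ h20
  · linear_combination e2 + h0 - h0'
  · linear_combination e1 - hI
  · linear_combination e1 + hI
  · linear_combination - e2 + h0 - h0'
end C
end HallSL

namespace HallSL
open Matrix

set_option linter.unusedSectionVars false
set_option linter.style.haveILetI false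
set_option linter.unusedVariables false
set_option linter.deprecated false

section C
variable {F : Type*} [Field F] (a b : F) (hab : a * a + b * b = -1)

lemma w_pow (h20 : (2 : F) ≠ 0) : qw a b hab h20 ^ 3 = 1 := by
  rw [pow_succ, pow_two, w_cube, inv_mul_cancel]

lemma w_ne (h20 : (2 : F) ≠ 0) : qw a b hab h20 ≠ 1 ∧ qw a b hab h20 ≠ -1 := by
  have e := wI a b hab h20
  constructor
  · intro h
    rw [h, one_mul, mul_one] at e
    exact not_sim_IJ a b hab h20 (Or.inl e)
  · intro h
    rw [h] at e
    exact not_sim_IJ a b hab h20 (Or.inl (by simpa using e))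

lemma dvd24 [Finite F] (h20 : (2 : F) ≠ 0) {L : Subgroup (SL2 F)} (hQ : Q8 a b hab ≤ L)
    (hw : qw a b hab h20 ∈ L) : 24 ∣ Nat.card L := by
  have h8 := eight_dvd a b hab h20 hQ
  have : Fact (Nat.Prime 3) := ⟨Nat.prime_three⟩
  have h3 : 3 ∣ Nat.card L := by
    have := Subgroup.orderOf_dvd_natCard L hw
    rwa [orderOf_eq_prime (w_pow a b hab h20) (w_ne a b hab h20).1] at this
  have := Nat.Coprime.mul_dvd_of_dvd_of_dvd (by norm_num : Nat.Coprime 8 3) h8 h3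
  simpa using this

lemma case24 [Finite F] (h20 : (2 : F) ≠ 0) {H H' : Subgroup (SL2 F)} (hQ : Q8 a b hab ≤ H)
    (hw : qw a b hab h20 ∈ H) (hQ' : Q8 a b hab ≤ H') (hw' : qw a b hab h20 ∈ H')
    (hc : Nat.card H = 24) (hc' : Nat.card H' = 24) : H = H' := by
  have h := dvd24 a b hab h20 (L := H ⊓ H') (le_inf hQ hQ') ⟨hw, hw'⟩
  have hd := Subgroup.card_dvd_of_le (inf_le_left : H ⊓ H' ≤ H)
  rw [hc] at hd
  have he := Nat.dvd_antisymm hd h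
  have e1 : H ⊓ H' = H := eq_of_le_of_card inf_le_left (he.trans hc.symm)
  have e2 : H ⊓ H' = H' := eq_of_le_of_card inf_le_right (he.trans hc'.symm)
  rw [← e1, e2]

lemma w_tr (h20 : (2 : F) ≠ 0) : (qw a b hab h20).1.trace = -1 := by
  simp [qw, Matrix.trace_fin_two]; field_simp; ring

lemma tr_flip (h20 : (2 : F) ≠ 0) {x : SL2 F}
    (hx : x * qw a b hab h20 * x⁻¹ = (qw a b hab h20)⁻¹) :
    2 * (x * qw a b hab h20).1.trace = - x.1.trace ∧
    (x * (qw a b hab h20)⁻¹).1.trace = (x * qw a b hab h20).1.trace := by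
  have h1 : x * qw a b hab h20 = (qw a b hab h20)⁻¹ * x := by
    rw [← hx]; group
  have h2 : (x * (qw a b hab h20)⁻¹).1.trace = (x * qw a b hab h20).1.trace := by
    rw [h1, SLmul, SLmul, Matrix.trace_mul_comm]
  refine ⟨?_, h2⟩
  rw [SLmul, SL_inv_val, w_tr, mul_sub, trace_sub, ← SLmul] at h2
  simp at h2
  linear_combination -h2

lemma tr0 (h20 : (2 : F) ≠ 0) (h30 : (3 : F) ≠ 0) {x : SL2 F}
    (hx : x * qw a b hab h20 * x⁻¹ = (qw a b hab h20)⁻¹) :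
    x.1.trace = 0 ∧ (x * qw a b hab h20).1.trace = 0 := by
  obtain ⟨h1, h2⟩ := tr_flip a b hab h20 hx
  obtain ⟨h3, h4⟩ := tr_flip a b hab h20 (x := x * qw a b hab h20) (by rw [← hx]; group)
  rw [mul_assoc x, w_cube, h2] at h3
  have h5 : (x * qw a b hab h20).1.trace = 0 := by
    apply mul_left_cancel₀ h30; linear_combination h3
  refine ⟨?_, h5⟩
  rw [h5, mul_zero] at h1
  exact neg_eq_zero.1 h1.symm

lemma exists_x (h20 : (2 : F) ≠ 0) (h30 : (3 : F) ≠ 0) (h50 : (5 : F) ≠ 0) {H : Subgroup (SL2 F)}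
    (hQ : Q8 a b hab ≤ H) (hw : qw a b hab h20 ∈ H)
    (hpow : ∀ g ∈ H, g ≠ 1 → g ≠ -1 → g ^ 4 = 1 ∨ g ^ 6 = 1 ∨ g ^ 10 = 1)
    (hinv : ∀ g ∈ H, g ≠ 1 → g ≠ -1 → ∃ y ∈ H, y * g * y⁻¹ = g⁻¹) :
    ∃ x ∈ H, x.1.trace = 0 ∧ (x * qI F).1.trace = 1 ∧ ∃ c : F, c ^ 2 + c - 1 = 0 ∧
      (x * qJ a b hab).1.trace = c ∧ (x * (qI F * qJ a b hab)).1.trace = -1 - c := by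
  have hIH : qI F ∈ H := hQ (I_mem a b hab)
  have hJH : qJ a b hab ∈ H := hQ (J_mem a b hab)
  have hKH := H.mul_mem hIH hJH
  obtain ⟨x, hxH, hx⟩ := hinv _ hw (w_ne a b hab h20).1 (w_ne a b hab h20).2
  obtain ⟨hx0, hxw⟩ := tr0 a b hab h20 h30 hx
  have hs := tr_w a b hab h20 x
  rw [hxw, hx0] at hs
  have hfl := field_lem h20 h30 h50 (B := (x * qI F).1.trace) (C := (x * qJ a b hab).1.trace)
    (D := (x * (qI F * qJ a b hab)).1.trace) (by linear_combination hs) (tr_sq a b hab hx0)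
    (trace_PT h20 (hpow _ (H.mul_mem hxH hIH))) (trace_PT h20 (hpow _ (H.mul_mem hxH hJH)))
  -- final step
  have hfin : ∀ y ∈ H, y.1.trace = 0 → (y * qI F).1.trace + (y * qJ a b hab).1.trace +
      (y * (qI F * qJ a b hab)).1.trace = 0 → (y * qI F).1.trace = 1 → ∃ x ∈ H, x.1.trace = 0 ∧ (x * qI F).1.trace = 1 ∧ ∃ c : F, c ^ 2 + c - 1 = 0 ∧
      (x * qJ a b hab).1.trace = c ∧ (x * (qI F * qJ a b hab)).1.trace = -1 - c := by
    intro y hy h0 hs h1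
    refine ⟨y, hy, h0, h1, _, ?_, rfl, by linear_combination hs - h1⟩
    have hq := tr_sq a b hab h0
    have hK : (y * (qI F * qJ a b hab)).1.trace = -1 - (y * qJ a b hab).1.trace := by
      linear_combination hs - h1
    rw [hK, h1] at hq
    apply mul_left_cancel₀ h20
    linear_combination hq
  have hfin2 : ∀ y ∈ H, y.1.trace = 0 → (y * qI F).1.trace + (y * qJ a b hab).1.trace +
      (y * (qI F * qJ a b hab)).1.trace = 0 → ((y * qI F).1.trace = 1 ∨ (y * qI F).1.trace = -1) → ∃ x ∈ H, x.1.trace = 0 ∧ (x * qI F).1.trace = 1 ∧ ∃ c : F, c ^ 2 + c - 1 = 0 ∧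
      (x * qJ a b hab).1.trace = c ∧ (x * (qI F * qJ a b hab)).1.trace = -1 - c := by
    intro y hy h0 hs h1
    rcases h1 with h1 | h1
    · exact hfin y hy h0 hs h1
    · refine hfin (-y) (sim.mem (hQ (neg_mem a b hab)) (Or.inr rfl) hy) ?_ ?_ ?_
      · rw [SLneg, trace_neg, h0, neg_zero]
      · simp only [neg_mul, SLneg, trace_neg]
        linear_combination -hs
      · rw [neg_mul, SLneg, trace_neg, h1, neg_neg]
  have e1 : qw a b hab h20 * qI F * (qw a b hab h20)⁻¹ = qJ a b hab := by
    rw [wI, mul_inv_cancel_right]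
  have e2 : qw a b hab h20 * qJ a b hab * (qw a b hab h20)⁻¹ = qI F * qJ a b hab := by
    rw [wJ, mul_inv_cancel_right]
  have e3 : qw a b hab h20 * (qI F * qJ a b hab) * (qw a b hab h20)⁻¹ = qI F := by
    calc _ = (qw a b hab h20 * qI F * (qw a b hab h20)⁻¹) * (qw a b hab h20 * qJ a b hab * (qw a b hab h20)⁻¹) := by group
      _ = qJ a b hab * (qI F * qJ a b hab) := by rw [e1, e2]
      _ = qI F := by rw [← mul_assoc, JI, neg_mul, mul_assoc, JJ]; simp
  have hrot : ∀ y u v : SL2 F, qw a b hab h20 * u * (qw a b hab h20)⁻¹ = v →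
      ((qw a b hab h20 * y * (qw a b hab h20)⁻¹) * v).1.trace = (y * u).1.trace := by
    rintro y u _ rfl
    rw [← trace_conj (qw a b hab h20) (y * u)]
    have e : qw a b hab h20 * y * (qw a b hab h20)⁻¹ * (qw a b hab h20 * u * (qw a b hab h20)⁻¹) =
        qw a b hab h20 * (y * u) * (qw a b hab h20)⁻¹ := by group
    rw [e]
  have hrot0 : ∀ y : SL2 F, (qw a b hab h20 * y * (qw a b hab h20)⁻¹).1.trace = y.1.trace :=
    fun y => trace_conj _ y
  have hwm : ∀ y ∈ H, qw a b hab h20 * y * (qw a b hab h20)⁻¹ ∈ H :=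
    fun y hy => H.mul_mem (H.mul_mem hw hy) (H.inv_mem hw)
  have hD : ∀ y ∈ H, y.1.trace = 0 → (y * qI F).1.trace + (y * qJ a b hab).1.trace +
      (y * (qI F * qJ a b hab)).1.trace = 0 → ((y * (qI F * qJ a b hab)).1.trace = 1 ∨ (y * (qI F * qJ a b hab)).1.trace = -1) → ∃ x ∈ H, x.1.trace = 0 ∧ (x * qI F).1.trace = 1 ∧ ∃ c : F, c ^ 2 + c - 1 = 0 ∧
      (x * qJ a b hab).1.trace = c ∧ (x * (qI F * qJ a b hab)).1.trace = -1 - c := by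
    intro y hy h0 hs h1
    refine hfin2 _ (hwm y hy) (by rw [hrot0, h0]) ?_ ?_
    · rw [hrot y _ _ e1, hrot y _ _ e2, hrot y _ _ e3]; linear_combination hs
    · rw [hrot y _ _ e3]; exact h1
  rcases hfl with h | h | h
  · exact hfin2 x hxH hx0 (by linear_combination hs) h
  · refine hD _ (hwm x hxH) (by rw [hrot0, hx0]) ?_ ?_
    · rw [hrot x _ _ e1, hrot x _ _ e2, hrot x _ _ e3]; linear_combination hs
    · rw [hrot x _ _ e2]; exact h
  · exact hD x hxH hx0 (by linear_combination hs) h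

/-- such an x does not normalize Q8 -/
lemma x_not_norm (h20 : (2 : F) ≠ 0) (h30 : (3 : F) ≠ 0) {x : SL2 F} (h0 : x.1.trace = 0)
    (h1 : (x * qI F).1.trace = 1) : ¬ x * qI F * x⁻¹ ∈ Q8 a b hab := by
  intro h
  set q := x * qI F * x⁻¹ with hq
  have e1 : x * qI F = q * x := by rw [hq]; group
  have e2 : (q.1 + (qI F).1) * x.1 = 1 := by
    rw [add_mul, ← SLmul, ← e1, SLmul]
    rw [trI] at h1
    rw [Matrix.trace_fin_two] at h0
    apply ext2 <;> simp only [qI, Matrix.add_apply, Matrix.mul_apply, Fin.sum_univ_two, Matrix.of_apply,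
      Matrix.cons_val', Matrix.cons_val_zero, Matrix.cons_val_one, Matrix.one_apply] <;> simp
    · linear_combination h1
    · linear_combination h0
    · linear_combination -h0
    · linear_combination h1
  have e3 : (q.1 + (qI F).1).det = 1 := by
    have := congrArg Matrix.det e2
    rwa [Matrix.det_mul, x.2, mul_one, det_one] at this
  have e4 : q.1 1 0 - q.1 0 1 = 1 := by
    have hd := q.2
    rw [Matrix.det_fin_two] at hd e3
    simp [qI] at e3
    linear_combination hd - e3
  have h10 : (1 : F) ≠ 0 := one_ne_zero
  have c1 : (1 : SL2 F).1 1 0 - (1 : SL2 F).1 0 1 = 0 := by simp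
  have c2 : (qI F).1 1 0 - (qI F).1 0 1 = -2 := by simp [qI]; ring
  have c3 : (qJ a b hab).1 1 0 - (qJ a b hab).1 0 1 = 0 := by simp [qJ]
  have c4 : (qI F * qJ a b hab).1 1 0 - (qI F * qJ a b hab).1 0 1 = 0 := by
    rw [SLmul]; simp [qI, qJ, Matrix.mul_apply, Fin.sum_univ_two]
  rcases Q8_exh a b hab h20 h with (h | h) | (h | h) | (h | h) | (h | h) <;>
    rw [h] at e4 <;> (try rw [SLneg, Matrix.neg_apply, Matrix.neg_apply] at e4)
  · exact h10 (by linear_combination c1 - e4)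
  · exact h10 (by linear_combination -c1 - e4)
  · exact h30 (by linear_combination c2 - e4)
  · exact h10 (by linear_combination c2 + e4)
  · exact h10 (by linear_combination c3 - e4)
  · exact h10 (by linear_combination -c3 - e4)
  · exact h10 (by linear_combination c4 - e4)
  · exact h10 (by linear_combination -c4 - e4)

lemma case120 [Finite F] (h20 : (2 : F) ≠ 0) (h30 : (3 : F) ≠ 0) {H H' : Subgroup (SL2 F)} (hQ : Q8 a b hab ≤ H)
    (hw : qw a b hab h20 ∈ H) (hQ' : Q8 a b hab ≤ H') (hw' : qw a b hab h20 ∈ H')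
    (hc : Nat.card H = 120) (hc' : Nat.card H' = 120) {x : SL2 F} (hx : x ∈ H) (hx' : x ∈ H')
    (h0 : x.1.trace = 0) (h1 : (x * qI F).1.trace = 1) : H = H' := by
  have h := dvd24 a b hab h20 (L := H ⊓ H') (le_inf hQ hQ') ⟨hw, hw'⟩
  have hd := Subgroup.card_dvd_of_le (inf_le_left : H ⊓ H' ≤ H)
  rw [hc] at hd
  have hne : Nat.card ↥(H ⊓ H') ≠ 24 := by
    intro h24
    set M := Q8 a b hab ⊔ Subgroup.zpowers (qw a b hab h20) with hM
    have hML : M ≤ H ⊓ H' := by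
      apply sup_le (le_inf hQ hQ')
      rw [Subgroup.zpowers_le]; exact ⟨hw, hw'⟩
    have hMd := dvd24 a b hab h20 (L := M) le_sup_left
      ((le_sup_right : _ ≤ M) (Subgroup.mem_zpowers _))
    have hMd' := Subgroup.card_dvd_of_le hML
    rw [h24] at hMd'
    have hMe := eq_of_le_of_card hML ((Nat.dvd_antisymm hMd' hMd).trans h24.symm)
    have hMN : M ≤ Subgroup.normalizer (Q8 a b hab) := by
      apply sup_le Subgroup.le_normalizer
      rw [Subgroup.zpowers_le, Subgroup.mem_normalizer_iff]
      intro y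
      refine ⟨fun h => w_mem_norm a b hab h20 h, fun h => ?_⟩
      have := w_mem_norm a b hab h20 (w_mem_norm a b hab h20 h)
      have hp := w_pow a b hab h20
      have e : qw a b hab h20 * (qw a b hab h20 * (qw a b hab h20 * y * (qw a b hab h20)⁻¹) * (qw a b hab h20)⁻¹) * (qw a b hab h20)⁻¹ =
          qw a b hab h20 ^ 3 * y * (qw a b hab h20 ^ 3)⁻¹ := by
        generalize qw a b hab h20 = w
        simp only [pow_succ, pow_zero, one_mul, mul_assoc, _root_.mul_inv_rev]
      rw [e, hp] at this
      simpa using this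
    have hxM : x ∈ M := by rw [hMe]; exact ⟨hx, hx'⟩
    have := (Subgroup.mem_normalizer_iff.1 (hMN hxM) _).1 (I_mem a b hab)
    exact x_not_norm a b hab h20 h30 h0 h1 this
  have he : Nat.card ↥(H ⊓ H') = 120 := by
    obtain ⟨k, hk⟩ := h
    rw [hk] at hd hne ⊢
    have hk5 : k ∣ 5 := Nat.dvd_of_mul_dvd_mul_left (by norm_num : 0 < 24) hd
    rcases (Nat.dvd_prime Nat.prime_five).1 hk5 with rfl | rfl
    · exact absurd rfl hne
    · rfl
  have e1 : H ⊓ H' = H := eq_of_le_of_card inf_le_left (he.trans hc.symm)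
  have e2 : H ⊓ H' = H' := eq_of_le_of_card inf_le_right (he.trans hc'.symm)
  rw [← e1, e2]
end C
end HallSL

namespace HallSL
open Matrix

set_option linter.unusedSectionVars false
set_option linter.style.haveILetI false
set_option linter.unusedVariables false
set_option linter.deprecated false

section Abs
variable {H : Type*} [Group H] [Finite H] {z : H}

lemma exists_third {L : Subgroup H} (u v : H) (h : 2 < Nat.card L) : ∃ y ∈ L, y ≠ u ∧ y ≠ v := by
  by_contra hc
  push Not at hc
  have hs : (L : Set H) ⊆ {u, v} := by
    intro y hy
    by_cases h : y = u
    · exact Or.inl h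
    · exact Or.inr (hc y hy h)
  have h1 := Set.ncard_le_ncard hs (Set.toFinite _)
  have h2 : ({u, v} : Set H).ncard ≤ 2 := Set.ncard_insert_le u {v} |>.trans (by simp)
  have h3 : (L : Set H).ncard = Nat.card L := rfl
  omega

lemma abel_cent (hcard : ∀ x : H, x ≠ 1 → x ≠ z → Nat.card (Subgroup.centralizer {x}) = 4 ∨
        Nat.card (Subgroup.centralizer {x}) = 6 ∨ Nat.card (Subgroup.centralizer {x}) = 8)
    {A : Subgroup H} (hA : ∀ a ∈ A, ∀ b ∈ A, a * b = b * a) (h8 : Nat.card A = 8) {x : H} (hx : x ∈ A)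
    (h1 : x ≠ 1) (h2 : x ≠ z) : A = Subgroup.centralizer {x} := by
  have hle : A ≤ Subgroup.centralizer {x} := fun y hy =>
    Subgroup.mem_centralizer_singleton_iff.2 (hA _ hy _ hx)
  apply eq_of_le_of_card hle
  have hd := Subgroup.card_dvd_of_le hle
  rw [h8] at hd ⊢
  rcases hcard x h1 h2 with h | h | h <;> rw [h] at hd ⊢ <;> revert hd <;> decide

lemma no_normal_abel (hz1 : z ≠ 1) (hz2 : z * z = 1) (hzc : ∀ x, z * x = x * z)
    (hsq : ∀ x : H, x * x = 1 → x = 1 ∨ x = z) (hH : Nat.card H = 48)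
    (hcard : ∀ x : H, x ≠ 1 → x ≠ z → Nat.card (Subgroup.centralizer {x}) = 4 ∨
        Nat.card (Subgroup.centralizer {x}) = 6 ∨ Nat.card (Subgroup.centralizer {x}) = 8)
    {A : Subgroup H} (hA : ∀ a ∈ A, ∀ b ∈ A, a * b = b * a) (h8 : Nat.card A = 8) :
    ¬ A.Normal := by
  intro hn
  obtain ⟨x, hxA, hx1, hxz⟩ := exists_third (L := A) 1 z (by omega)
  have hy : ∃ y ∈ A, y * y = z := by
    have h := Subgroup.orderOf_dvd_natCard A hxA
    rw [h8] at h
    have h := orderOf_dvd_iff_pow_eq_one.1 h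
    have e : (x ^ 4) * (x ^ 4) = 1 := by rw [← pow_add]; exact h
    rcases hsq _ e with h4 | h4
    · have e : (x ^ 2) * (x ^ 2) = 1 := by rw [← pow_add]; exact h4
      rcases hsq _ e with h5 | h5
      · rcases hsq x (by rw [← pow_two]; exact h5) with h6 | h6
        · exact absurd h6 hx1
        · exact absurd h6 hxz
      · exact ⟨x, hxA, by rw [← pow_two]; exact h5⟩
    · exact ⟨x ^ 2, A.pow_mem hxA 2, by rw [← pow_add]; exact h4⟩
  obtain ⟨y, hyA, hyy⟩ := hy
  have hy1 : y ≠ 1 := by rintro rfl; exact hz1 (by simpa using hyy.symm)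
  have hyz : y ≠ z := by rintro rfl; exact hz1 (by rw [← hyy, hz2])
  haveI : Fact (Nat.Prime 3) := ⟨Nat.prime_three⟩
  obtain ⟨t, ht⟩ := exists_prime_orderOf_dvd_card' (G := H) 3 (by rw [hH]; norm_num)
  have ht3 : t * t * t = 1 := by
    have := pow_orderOf_eq_one t
    rw [ht] at this
    simpa [pow_succ] using this
  have hzA : z ∈ A := by rw [← hyy]; exact A.mul_mem hyA hyA
  have key : t * y * t⁻¹ = y ∨ t * y * t⁻¹ = z * y := by
    have hm : t * y * t⁻¹ ∈ A := hn.conj_mem y hyA t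
    have hs : (t * y * t⁻¹) * (t * y * t⁻¹) = z := by
      calc _ = t * (y * y) * t⁻¹ := by group
        _ = z := by rw [hyy, ← hzc t, mul_inv_cancel_right]
    have hc := hA _ hm _ (A.inv_mem hyA)
    have : (t * y * t⁻¹ * y⁻¹) * (t * y * t⁻¹ * y⁻¹) = 1 := by
      calc _ = t * y * t⁻¹ * (y⁻¹ * (t * y * t⁻¹)) * y⁻¹ := by group
        _ = (t * y * t⁻¹) * (t * y * t⁻¹) * (y * y)⁻¹ := by rw [← hc]; group
        _ = 1 := by rw [hs, hyy, mul_inv_cancel]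
    rcases hsq _ this with h | h
    · left; exact mul_inv_eq_one.1 h
    · right; exact mul_inv_eq_iff_eq_mul.1 h
  have hcomm : (t * t) * y = y * (t * t) := by
    rcases key with h | h
    · have h' := mul_inv_eq_iff_eq_mul.1 h
      rw [mul_assoc, h', ← mul_assoc, h', mul_assoc]
    · have h' := mul_inv_eq_iff_eq_mul.1 h
      calc (t * t) * y = t * (t * y) := by group
        _ = (t * z) * (y * t) := by rw [h']; group
        _ = z * (t * y) * t := by rw [← hzc]; group
        _ = (z * z) * y * (t * t) := by rw [h']; group
        _ = _ := by rw [hz2, one_mul]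
  have hAc := abel_cent hcard hA h8 hyA hy1 hyz
  have htA : t * t ∈ A := by rw [hAc]; exact Subgroup.mem_centralizer_singleton_iff.2 hcomm
  have htA' : t ∈ A := by
    have := A.mul_mem htA htA
    have e : t * t * (t * t) = t := by rw [← mul_assoc, ht3, one_mul]
    rwa [e] at this
  have := Subgroup.orderOf_dvd_natCard A htA'
  rw [ht, h8] at this
  revert this; decide

lemma abs48 (hz1 : z ≠ 1) (hz2 : z * z = 1) (hzc : ∀ x, z * x = x * z)
    (hsq : ∀ x : H, x * x = 1 → x = 1 ∨ x = z) (hH : Nat.card H = 48)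
    (hct : ∀ x a b : H, x ≠ 1 → x ≠ z → x * a = a * x → x * b = b * x → a * b = b * a)
    (hcard : ∀ x : H, x ≠ 1 → x ≠ z → Nat.card (Subgroup.centralizer {x}) = 4 ∨
        Nat.card (Subgroup.centralizer {x}) = 6 ∨ Nat.card (Subgroup.centralizer {x}) = 8)
    (hex : ∃ x : H, x ≠ 1 ∧ x ≠ z ∧ Nat.card (Subgroup.centralizer {x}) = 8) :
    ∃ A R E : Subgroup H, A ≤ R ∧ (∀ a ∈ A, ∀ b ∈ A, a * b = b * a) ∧ Nat.card A = 8 ∧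
      Nat.card R = 16 ∧ E.Normal ∧ Nat.card E = 8 ∧ ∃ i ∈ E, ∃ j ∈ E, i * j ≠ j * i := by
  obtain ⟨x, hx1, hxz, hx8⟩ := hex
  haveI : Fact (Nat.Prime 2) := ⟨Nat.prime_two⟩
  have hA : ∀ a ∈ Subgroup.centralizer {x}, ∀ b ∈ Subgroup.centralizer {x}, a * b = b * a := by
    intro a ha b hb
    exact hct x a b hx1 hxz (Subgroup.mem_centralizer_singleton_iff.1 ha).symm
      (Subgroup.mem_centralizer_singleton_iff.1 hb).symm
  have hxA : x ∈ Subgroup.centralizer {x} := Subgroup.mem_centralizer_singleton_iff.2 rfl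
  set A := Subgroup.centralizer {x} with hAdef
  obtain ⟨R, hR⟩ := (IsPGroup.iff_card.2 ⟨3, by rw [hx8]; norm_num⟩ : IsPGroup 2 A).exists_le_sylow
  have hR16 : Nat.card (R : Subgroup H) = 16 := by
    have h := R.card_eq_multiplicity
    rw [hH] at h
    have : Nat.factorization 48 2 = 4 := by
      rw [show (48 : ℕ) = 2 ^ 4 * 3 by norm_num, Nat.factorization_mul (by norm_num) (by norm_num),
        Nat.factorization_pow, Nat.prime_three.factorization, Nat.prime_two.factorization]
      simp
    rw [this] at h
    exact h
  set E := (R : Subgroup H).normalCore with hE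
  have hER : E ≤ R := Subgroup.normalCore_le _
  have hi3 : (R : Subgroup H).index = 3 := by
    have := Subgroup.card_mul_index (R : Subgroup H)
    rw [hR16, hH] at this; omega
  have hi6 : E.index ∣ 6 := by
    have h1 : E.index ∣ Nat.card (Equiv.Perm (H ⧸ (R : Subgroup H))) := by
      rw [hE, Subgroup.normalCore_eq_ker, Subgroup.index_ker]
      exact Subgroup.card_subgroup_dvd_card _
    rw [Nat.card_perm, ← Subgroup.index_eq_card, hi3] at h1
    exact h1
  have hd3 : 3 ∣ E.index := by rw [← hi3]; exact Subgroup.index_dvd_of_le hER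
  have hmul := Subgroup.card_mul_index E
  rw [hH] at hmul
  have hcE : Nat.card E = 8 ∨ Nat.card E = 16 := by
    have : E.index ≤ 6 := Nat.le_of_dvd (by norm_num) hi6
    interval_cases E.index <;> omega
  have hEn : E.Normal := Subgroup.normalCore_normal _
  refine ⟨A, R, E, hR, hA, hx8, hR16, hEn, ?_⟩
  have hE8 : Nat.card E = 8 := by
    rcases hcE with h | h
    · exact h
    exfalso
    have hEeq : E = R := eq_of_le_of_card hER (h.trans hR16.symm)
    apply no_normal_abel hz1 hz2 hzc hsq hH hcard hA hx8
    constructor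
    intro n hn g
    -- A and its conjugate agree
    have hBR : conjSub g A ≤ R := by
      intro y hy
      rw [mem_conjSub] at hy
      have := hR hy
      rw [← hEeq] at this ⊢
      have := hEn.conj_mem _ this g
      convert this using 1
      group
    have hB8 : Nat.card (conjSub g A) = 8 := by rw [conjSub_card, hx8]
    have r1 := card_relIndex hR
    have r2 := card_relIndex hBR
    rw [hx8, hR16] at r1
    rw [hB8, hR16] at r2
    have r3 := card_relIndex (inf_le_left.trans hR : A ⊓ conjSub g A ≤ R)
    have r4 := Subgroup.relIndex_inf_le (H := A) (K := conjSub g A) (L := (R : Subgroup H))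
    rw [show A.relIndex R = 2 by omega, show (conjSub g A).relIndex R = 2 by omega] at r4
    rw [hR16] at r3
    obtain ⟨y, hy, hy1, hyz⟩ := exists_third (L := A ⊓ conjSub g A) 1 z (by
      by_contra hcon
      push Not at hcon
      have := Nat.mul_le_mul hcon r4
      omega)
    have hBab : ∀ a ∈ conjSub g A, ∀ b ∈ conjSub g A, a * b = b * a := by
      intro a ha b hb
      have := hA _ (mem_conjSub.1 ha) _ (mem_conjSub.1 hb)
      have := congrArg (fun t => g * t * g⁻¹) this
      convert this using 1 <;> group
    have e1 := abel_cent hcard hA hx8 hy.1 hy1 hyz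
    have e2 := abel_cent hcard hBab hB8 hy.2 hy1 hyz
    rw [e1, ← e2, mem_conjSub]
    convert hn using 1
    group
  refine ⟨hE8, ?_⟩
  by_contra hcon
  push Not at hcon
  exact no_normal_abel hz1 hz2 hzc hsq hH hcard hcon hE8 hEn

end Abs

section S
variable {F : Type*} [Field F] [Finite F]

lemma neg_mem_of_even (h20 : (2 : F) ≠ 0) {L : Subgroup (SL2 F)} (h : 2 ∣ Nat.card L) : -1 ∈ L := by
  haveI : Fact (Nat.Prime 2) := ⟨Nat.prime_two⟩
  obtain ⟨t, ht⟩ := exists_prime_orderOf_dvd_card' (G := L) 2 h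
  have h1 : (t : SL2 F) * t = 1 := by
    have := pow_orderOf_eq_one t
    rw [ht, pow_two] at this
    exact congrArg Subtype.val this
  rcases SL_sq_one h20 h1 with h | h
  · exfalso
    have : t = 1 := Subtype.ext h
    rw [this, orderOf_one] at ht
    omega
  · rw [← h]; exact t.2

lemma norm_bound (h20 : (2 : F) ≠ 0) {E : Subgroup (SL2 F)} (h8 : Nat.card E = 8)
    {i j : SL2 F} (hi : i ∈ E) (hj : j ∈ E) (hij : i * j ≠ j * i) {N : Subgroup (SL2 F)}
    (hN : ∀ n ∈ N, ∀ e ∈ E, n * e * n⁻¹ ∈ E) : Nat.card N ≤ 72 := by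
  classical
  haveI := Fintype.ofFinite (SL2 F)
  set T : Finset (SL2 F) := ((E : Set (SL2 F)).toFinset.erase 1).erase (-1) with hT
  have hz : -1 ∈ E := neg_mem_of_even h20 (by rw [h8]; norm_num)
  have hTc : T.card = 6 := by
    have h0 : (E : Set (SL2 F)).toFinset.card = 8 := by
      rw [← h8, Set.toFinset_card, ← Nat.card_eq_fintype_card]; rfl
    have h1 : (1 : SL2 F) ∈ (E : Set (SL2 F)).toFinset := by simp [E.one_mem]
    rw [hT, Finset.card_erase_of_mem, Finset.card_erase_of_mem h1, h0]
    rw [Finset.mem_erase]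
    exact ⟨(one_ne_neg h20).symm, by simpa using hz⟩
  have hmem : ∀ e, e ∈ T ↔ e ≠ -1 ∧ e ≠ 1 ∧ e ∈ E := by
    intro e; simp [hT]
  have hconj : ∀ n ∈ N, ∀ e, e ∈ T → n * e * n⁻¹ ∈ T := by
    intro n hn e he
    rw [hmem] at he ⊢
    refine ⟨?_, ?_, hN n hn e he.2.2⟩
    · intro h
      apply he.1
      rw [mul_inv_eq_iff_eq_mul] at h
      apply mul_left_cancel (a := n)
      rw [h]; simp
    · intro h
      apply he.2.1
      rw [mul_inv_eq_iff_eq_mul] at h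
      apply mul_left_cancel (a := n)
      rw [h]; simp
  have hiT : i ∈ T := by
    rw [hmem]
    refine ⟨?_, ?_, hi⟩
    · rintro rfl; apply hij; simp
    · rintro rfl; apply hij; simp
  have hjT : j ∈ T := by
    rw [hmem]
    refine ⟨?_, ?_, hj⟩
    · rintro rfl; apply hij; simp
    · rintro rfl; apply hij; simp
  have hb := Finset.card_le_mul_card_image_of_maps_to (s := (N : Set (SL2 F)).toFinset) (t := T ×ˢ T)
    (f := fun n => (n * i * n⁻¹, n * j * n⁻¹)) (by
      intro n hn
      have hn : n ∈ N := by simpa using hn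
      exact Finset.mem_product.2 ⟨hconj n hn i hiT, hconj n hn j hjT⟩) 2 (by
      intro p _
      by_cases hne : ∃ n0 : SL2 F, (n0 * i * n0⁻¹, n0 * j * n0⁻¹) = p
      · obtain ⟨n0, rfl⟩ := hne
        refine (Finset.card_le_card (t := {n0, -n0}) ?_).trans Finset.card_le_two
        intro n hn
        have hn := (Finset.mem_filter.1 hn).2
        have h1 := congrArg Prod.fst hn
        have h2 := congrArg Prod.snd hn
        simp only at h1 h2
        have hc : ∀ u : SL2 F, n * u * n⁻¹ = n0 * u * n0⁻¹ → (n0⁻¹ * n) * u = u * (n0⁻¹ * n) := by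
          intro u h
          calc _ = n0⁻¹ * (n * u * n⁻¹) * n := by group
            _ = _ := by rw [h]; group
        have hor : n0⁻¹ * n = 1 ∨ n0⁻¹ * n = -1 := by
          by_contra hcon
          push Not at hcon
          exact hij (SL_comm_trans hcon.1 hcon.2 (hc i h1) (hc j h2))
        rw [Finset.mem_insert, Finset.mem_singleton]
        rcases hor with h | h
        · left; exact (inv_mul_eq_one.1 h).symm
        · right; rw [inv_mul_eq_iff_eq_mul] at h; rw [h]; simp
      · rw [Finset.card_eq_zero.2]
        · norm_num
        · rw [Finset.filter_eq_empty_iff]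
          intro n _ h
          exact hne ⟨n, h⟩)
  rw [Finset.card_product, hTc, Set.toFinset_card, ← Nat.card_eq_fintype_card] at hb
  exact hb

lemma norm_eq (h20 : (2 : F) ≠ 0) {E : Subgroup (SL2 F)} (h8 : Nat.card E = 8)
    {i j : SL2 F} (hi : i ∈ E) (hj : j ∈ E) (hij : i * j ≠ j * i) {H : Subgroup (SL2 F)}
    (hH : Nat.card H = 48) (hN : H ≤ Subgroup.normalizer E) : H = Subgroup.normalizer E := by
  apply eq_of_le_of_card hN
  have h1 := norm_bound h20 h8 hi hj hij (N := Subgroup.normalizer E)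
    (fun n hn e he => (Subgroup.mem_normalizer_iff.1 hn e).1 he)
  obtain ⟨k, hk⟩ := Subgroup.card_dvd_of_le hN
  have hpos : 0 < Nat.card (Subgroup.normalizer (E : Set (SL2 F))) := Nat.card_pos
  rw [hH] at hk ⊢
  omega

/-- the quaternion normal subgroup property -/
def NE (H E : Subgroup (SL2 F)) : Prop :=
  E ≤ H ∧ Nat.card E = 8 ∧ (∃ i ∈ E, ∃ j ∈ E, i * j ≠ j * i) ∧ H ≤ Subgroup.normalizer E

lemma NE_le {H E Q : Subgroup (SL2 F)} (hH : Nat.card H = 48) (h : NE H E) (hQ : Q ≤ H)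
    (hc : Nat.card Q = 16) : E ≤ Q := by
  haveI : Fact (Nat.Prime 2) := ⟨Nat.prime_two⟩
  have hp : IsPGroup 2 (Q ⊔ E : Subgroup (SL2 F)) :=
    IsPGroup.to_sup_of_normal_right' (IsPGroup.iff_card.2 ⟨4, by rw [hc]; norm_num⟩)
      (IsPGroup.iff_card.2 ⟨3, by rw [h.2.1]; norm_num⟩) (hQ.trans h.2.2.2)
  obtain ⟨n, hn⟩ := IsPGroup.iff_card.1 hp
  have hd := Subgroup.card_dvd_of_le (sup_le hQ h.1)
  rw [hn, hH] at hd
  have h16 : 2 ^ n ∣ 16 := by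
    have : Nat.Coprime (2 ^ n) 3 := Nat.Coprime.pow_left n (by norm_num)
    exact this.dvd_of_dvd_mul_right (show 2 ^ n ∣ 16 * 3 from hd)
  have hd2 := Subgroup.card_dvd_of_le (le_sup_left : Q ≤ Q ⊔ E)
  rw [hn, hc] at hd2
  have : Q = Q ⊔ E := eq_of_le_of_card le_sup_left (by rw [hc, hn]; exact Nat.dvd_antisymm hd2 h16)
  rw [this]; exact le_sup_right

lemma Eq_E (h20 : (2 : F) ≠ 0) {Q A E E' : Subgroup (SL2 F)} (hA : ∀ a ∈ A, ∀ b ∈ A, a * b = b * a)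
    (hAQ : A ≤ Q) (hQc : Nat.card Q = 16) (hA8 : Nat.card A = 8) {s : SL2 F} (hsQ : s ∈ Q) (hsA : s ∉ A)
    (hE : E ≤ Q) (hE' : E' ≤ Q) (h8 : Nat.card E = 8) (h8' : Nat.card E' = 8)
    (hn : ∃ i ∈ E, ∃ j ∈ E, i * j ≠ j * i) (hn' : ∃ i ∈ E', ∃ j ∈ E', i * j ≠ j * i)
    (hs : s ∈ E ↔ s ∈ E') : E = E' := by
  classical
  -- squares of A
  let f : A →* SL2 F := ⟨⟨fun x => x.1 * x.1, by simp⟩, by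
    intro x y
    have := hA _ x.2 _ y.2
    show x.1 * y.1 * (x.1 * y.1) = x.1 * x.1 * (y.1 * y.1)
    calc _ = x.1 * (y.1 * x.1) * y.1 := by group
      _ = _ := by rw [← this]; group⟩
  have hf : ∀ x : A, f x = x.1 * x.1 := fun _ => rfl
  set D := f.range with hD
  have hz : -1 ∈ A := neg_mem_of_even h20 (by rw [hA8]; norm_num)
  have hker : Nat.card f.ker ≤ 2 := by
    by_contra hc
    push Not at hc
    obtain ⟨y, hy, h1, h2⟩ := exists_third (L := f.ker) 1 ⟨-1, hz⟩ hc
    have := (MonoidHom.mem_ker).1 hy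
    rw [hf] at this
    rcases SL_sq_one h20 this with h | h
    · exact h1 (Subtype.ext h)
    · exact h2 (Subtype.ext h)
  have hDc : 4 ≤ Nat.card D := by
    have h1 := Subgroup.card_mul_index f.ker
    rw [Subgroup.index_ker, hA8] at h1
    by_contra hc
    push Not at hc
    have := Nat.mul_le_mul hker (Nat.le_of_lt_succ hc)
    rw [← hD] at h1
    omega
  have hDA : D ≤ A := by
    rintro _ ⟨x, rfl⟩
    exact A.mul_mem x.2 x.2
  have hsub : ∀ E : Subgroup (SL2 F), E ≤ Q → Nat.card E = 8 → (∃ i ∈ E, ∃ j ∈ E, i * j ≠ j * i) →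
      D ≤ E ∧ E ⊓ A = D := by
    intro E hE h8 hn
    have hh := half hE (by omega)
    have hDE : D ≤ E := by
      rintro _ ⟨x, rfl⟩
      exact hh.1 _ (hAQ x.2)
    refine ⟨hDE, ?_⟩
    have hle : D ≤ E ⊓ A := le_inf hDE hDA
    symm
    apply eq_of_le_of_card hle
    have hne : Nat.card ↥(E ⊓ A) ≠ 8 := by
      intro h
      have e1 : E ⊓ A = E := eq_of_le_of_card inf_le_left (by omega)
      obtain ⟨i, hi, j, hj, hij⟩ := hn
      rw [← e1] at hi hj
      exact hij (hA _ hi.2 _ hj.2)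
    have hd1 := Subgroup.card_dvd_of_le (inf_le_left : E ⊓ A ≤ E)
    have hd2 := Subgroup.card_dvd_of_le hle
    rw [h8] at hd1
    have hle8 := Nat.le_of_dvd (by norm_num) hd1
    have hpos : 0 < Nat.card ↥(E ⊓ A) := Nat.card_pos
    have hle4 := Nat.le_of_dvd hpos hd2
    have : Nat.card ↥(E ⊓ A) = 4 := by
      interval_cases Nat.card ↥(E ⊓ A) <;> omega
    omega
  obtain ⟨d1, d2⟩ := hsub E hE h8 hn
  obtain ⟨d1', d2'⟩ := hsub E' hE' h8' hn'
  have fin : ∀ u, u ∈ E → u ∈ E' → u ∉ D → E = E' := by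
    intro u hu hu' huD
    have hDle : D ≤ E ⊓ E' := le_inf d1 d1'
    have hd := Subgroup.card_dvd_of_le (inf_le_left : E ⊓ E' ≤ E)
    have hd2 := Subgroup.card_dvd_of_le hDle
    have hne : Nat.card D ≠ Nat.card ↥(E ⊓ E') := by
      intro h
      apply huD
      rw [eq_of_le_of_card hDle h]
      exact ⟨hu, hu'⟩
    have hpos : 0 < Nat.card ↥(E ⊓ E') := Nat.card_pos
    have hle := Nat.le_of_dvd hpos hd2
    rw [h8] at hd
    have hle8 := Nat.le_of_dvd (by norm_num) hd
    have : Nat.card ↥(E ⊓ E') = 8 := by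
      have : 4 < Nat.card ↥(E ⊓ E') := by omega
      interval_cases Nat.card ↥(E ⊓ E') <;> omega
    have e1 : E ⊓ E' = E := eq_of_le_of_card inf_le_left (by omega)
    have e2 : E ⊓ E' = E' := eq_of_le_of_card inf_le_right (by omega)
    rw [← e1, e2]
  by_cases hsE : s ∈ E
  · exact fin s hsE (hs.1 hsE) (fun h => hsA (hDA h))
  · have hsE' : s ∉ E' := fun h => hsE (hs.2 h)
    -- an element of A outside E
    obtain ⟨c, hcA, hcD⟩ : ∃ c ∈ A, c ∉ D := by
      by_contra hcon
      push Not at hcon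
      have e : A ≤ E := fun c hc => d1 (hcon c hc)
      have e' : A = E := eq_of_le_of_card e (by omega)
      obtain ⟨i, hi, j, hj, hij⟩ := hn
      rw [← e'] at hi hj
      exact hij (hA _ hi _ hj)
    have hcE : c ∉ E := fun h => hcD (by rw [← d2]; exact ⟨h, hcA⟩)
    have hcE' : c ∉ E' := fun h => hcD (by rw [← d2']; exact ⟨h, hcA⟩)
    refine fin (c * s) ((half hE (by omega)).2 _ (hAQ hcA) _ hsQ hcE hsE)
      ((half hE' (by omega)).2 _ (hAQ hcA) _ hsQ hcE' hsE') (fun h => hsA ?_)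
    have := A.mul_mem (A.inv_mem hcA) (hDA h)
    simpa using this

lemma case48 (h20 : (2 : F) ≠ 0) {Q A H H' : Subgroup (SL2 F)} (hA : ∀ a ∈ A, ∀ b ∈ A, a * b = b * a)
    (hAQ : A ≤ Q) (hQc : Nat.card Q = 16) (hA8 : Nat.card A = 8) {s : SL2 F} (hsQ : s ∈ Q) (hsA : s ∉ A)
    (hH : Nat.card H = 48) (hH' : Nat.card H' = 48) (hQ : Q ≤ H) (hQ' : Q ≤ H')
    (hE : ∃ E, NE H E) (hE' : ∃ E, NE H' E)
    (hP : (∃ E, NE H E ∧ s ∈ E) ↔ (∃ E, NE H' E ∧ s ∈ E)) : H = H' := by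
  have key : ∀ E E', NE H E → NE H' E' → (s ∈ E ↔ s ∈ E') → H = H' := by
    intro E E' hE hE' hs
    have := Eq_E h20 hA hAQ hQc hA8 hsQ hsA (NE_le hH hE hQ hQc) (NE_le hH' hE' hQ' hQc)
      hE.2.1 hE'.2.1 hE.2.2.1 hE'.2.2.1 hs
    subst this
    obtain ⟨i, hi, j, hj, hij⟩ := hE.2.2.1
    rw [norm_eq h20 hE.2.1 hi hj hij hH hE.2.2.2, norm_eq h20 hE.2.1 hi hj hij hH' hE'.2.2.2]
  by_cases h : ∃ E, NE H E ∧ s ∈ E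
  · obtain ⟨E, h1, h2⟩ := h
    obtain ⟨E', h3, h4⟩ := hP.1 ⟨E, h1, h2⟩
    exact key E E' h1 h3 ⟨fun _ => h4, fun _ => h2⟩
  · have h' : ¬ ∃ E, NE H' E ∧ s ∈ E := fun k => h (hP.2 k)
    obtain ⟨E, h1⟩ := hE
    obtain ⟨E', h3⟩ := hE'
    exact key E E' h1 h3 ⟨fun k => absurd ⟨E, h1, k⟩ h, fun k => absurd ⟨E', h3, k⟩ h'⟩

end S
end HallSL

namespace HallSL
open Matrix

set_option linter.unusedSectionVars false
set_option linter.style.haveILetI false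
set_option linter.unusedVariables false
set_option linter.deprecated false

section Fin
variable {F : Type*} [Field F] [Finite F]

lemma types (h20 : (2 : F) ≠ 0) {H : Subgroup (SL2 F)} (hN : (Nat.card H : F) ≠ 0) (hz : -1 ∈ H)
    (hna : ∃ x ∈ H, ∃ y ∈ H, x * y ≠ y * x) (hD : ¬ DT H) :
    (Nat.card H = 24 ∧ T4 H ⟨-1, hz⟩) ∨
    (Nat.card H = 48 ∧ (∀ x : H, x ≠ 1 → x ≠ ⟨-1, hz⟩ → Nat.card (Subgroup.centralizer {x}) = 4 ∨
        Nat.card (Subgroup.centralizer {x}) = 6 ∨ Nat.card (Subgroup.centralizer {x}) = 8) ∧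
      ∃ x : H, x ≠ 1 ∧ x ≠ ⟨-1, hz⟩ ∧ Nat.card (Subgroup.centralizer {x}) = 8) ∨
    (Nat.card H = 120 ∧ (∀ x : H, x ≠ 1 → x ≠ ⟨-1, hz⟩ → Nat.card (Subgroup.centralizer {x}) = 4 ∨
        Nat.card (Subgroup.centralizer {x}) = 6 ∨ Nat.card (Subgroup.centralizer {x}) = 10) ∧
      T4 H ⟨-1, hz⟩ ∧ ∀ x : H, x ≠ 1 → x ≠ ⟨-1, hz⟩ → ∃ y, y * x * y⁻¹ = x⁻¹) := by
  let K := AlgebraicClosure F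
  let φ : F →+* K := algebraMap F K
  have hφ : Function.Injective φ := φ.injective
  let ρ : H →* SL2 K := (Matrix.SpecialLinearGroup.map φ).comp H.subtype
  have hval : ∀ x : H, (ρ x).1 = x.1.1.map φ := fun x => rfl
  have hρ : Function.Injective ρ := by
    intro x y h
    have h' := congrArg Subtype.val h
    rw [hval, hval] at h'
    exact Subtype.ext (Subtype.ext (Matrix.map_injective hφ h'))
  have hρz : ρ ⟨-1, hz⟩ = -1 := by
    apply Subtype.ext
    rw [hval, SLneg, SLone]
    ext i j
    fin_cases i <;> fin_cases j <;> simp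
  have h20' : (2 : K) ≠ 0 := by
    intro h
    apply h20
    apply hφ
    rw [map_ofNat, map_zero]
    exact h
  have hN' : (Nat.card H : K) ≠ 0 := by
    intro h
    apply hN
    apply hφ
    rw [map_natCast, map_zero]
    exact h
  obtain ⟨x, hx, y, hy, hxy⟩ := hna
  have := thm1 h20' hρ hρz hN' ⟨⟨x, hx⟩, ⟨y, hy⟩, fun h => hxy (congrArg Subtype.val h)⟩
  rcases this with h | h
  · exfalso
    apply hD
    obtain ⟨A, hA, hc⟩ := h
    refine ⟨A.map H.subtype, ?_, ?_, ?_⟩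
    · rintro _ ⟨t, _, rfl⟩; exact t.2
    · rintro _ ⟨t, ht, rfl⟩ _ ⟨s, hs, rfl⟩
      exact congrArg Subtype.val (hA t ht s hs)
    · rw [Subgroup.card_map_of_injective H.subtype_injective]; exact hc
  · exact h

lemma sub48 (h20 : (2 : F) ≠ 0) {H : Subgroup (SL2 F)} (hz : -1 ∈ H) (hH : Nat.card H = 48)
    (hcard : ∀ x : H, x ≠ 1 → x ≠ ⟨-1, hz⟩ → Nat.card (Subgroup.centralizer {x}) = 4 ∨
        Nat.card (Subgroup.centralizer {x}) = 6 ∨ Nat.card (Subgroup.centralizer {x}) = 8)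
    (hex : ∃ x : H, x ≠ 1 ∧ x ≠ ⟨-1, hz⟩ ∧ Nat.card (Subgroup.centralizer {x}) = 8) :
    (∃ E, NE H E) ∧ ∃ A Q : Subgroup (SL2 F), (∀ a ∈ A, ∀ b ∈ A, a * b = b * a) ∧ A ≤ Q ∧
      Nat.card Q = 16 ∧ Nat.card A = 8 := by
  obtain ⟨A, R, E, h1, h2, h3, h4, h5, h6, i, hi, j, hj, hij⟩ := abs48 (H := H) (z := ⟨-1, hz⟩)
    (fun h => one_ne_neg h20 (congrArg Subtype.val h).symm)
    (Subtype.ext (by show (-1 : SL2 F) * -1 = 1; simp))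
    (fun x => Subtype.ext (by show (-1 : SL2 F) * x.1 = x.1 * -1; simp))
    (fun x hx => (SL_sq_one h20 (congrArg Subtype.val hx)).imp Subtype.ext Subtype.ext) hH
    (fun x a b hx1 hx2 ha hb => Subtype.ext (SL_comm_trans (x := x.1)
      (fun h => hx1 (Subtype.ext h)) (fun h => hx2 (Subtype.ext h))
      (congrArg Subtype.val ha) (congrArg Subtype.val hb))) hcard hex
  have hinj := H.subtype_injective
  constructor
  · refine ⟨E.map H.subtype, ?_, ?_, ?_, ?_⟩
    · rintro _ ⟨t, _, rfl⟩; exact t.2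
    · rw [Subgroup.card_map_of_injective hinj, h6]
    · exact ⟨i, ⟨i, hi, rfl⟩, j, ⟨j, hj, rfl⟩, fun h => hij (Subtype.ext h)⟩
    · intro n hn
      rw [Subgroup.mem_normalizer_iff]
      intro y
      constructor
      · rintro ⟨t, ht, rfl⟩
        exact ⟨_, h5.conj_mem t ht ⟨n, hn⟩, rfl⟩
      · rintro ⟨t, ht, h⟩
        refine ⟨_, h5.conj_mem t ht (⟨n, hn⟩⁻¹), ?_⟩
        have h : t.1 = n * y * n⁻¹ := h
        show n⁻¹ * t.1 * n⁻¹⁻¹ = y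
        rw [h]; group
  · refine ⟨A.map H.subtype, R.map H.subtype, ?_, Subgroup.map_mono h1, ?_, ?_⟩
    · rintro _ ⟨t, ht, rfl⟩ _ ⟨s, hs, rfl⟩
      exact congrArg Subtype.val (h2 t ht s hs)
    · rw [Subgroup.card_map_of_injective hinj, h4]
    · rw [Subgroup.card_map_of_injective hinj, h3]

theorem main (π : Set ℕ) (h2 : 2 ∈ π) (h3 : 3 ∈ π) (hp : ringChar F ∉ π)
    (hE : ∃ H : Subgroup (SL2 F), IsHallPi π H) : kPi π (SL2 F) ∈ ({1, 2, 3} : Set ℕ) := by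
  classical
  have hpp : (ringChar F).Prime := CharP.prime_ringChar F
  have hn0 : ∀ n : ℕ, IsPiNumber π n → (n : F) ≠ 0 := by
    intro n hn h
    exact hp (hn _ hpp (ringChar.dvd h))
  have h20 : (2 : F) ≠ 0 := by
    have := hn0 2 (by intro q hq hd; rw [(Nat.prime_dvd_prime_iff_eq hq Nat.prime_two).1 hd]; exact h2)
    exact_mod_cast this
  have h30 : (3 : F) ≠ 0 := by
    have := hn0 3 (by intro q hq hd; rw [(Nat.prime_dvd_prime_iff_eq hq Nat.prime_three).1 hd]; exact h3)
    exact_mod_cast this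
  obtain ⟨a, b, hab⟩ : ∃ a b : F, a * a + b * b = -1 := by
    haveI : NeZero (ringChar F) := ⟨hpp.ne_zero⟩
    obtain ⟨a, b, h⟩ := CharP.sq_add_sq F (ringChar F) (-1)
    exact ⟨a, b, by push_cast at h; linear_combination h⟩
  have hQp := Q8_pgroup a b hab h20
  have hQ8 : ∀ H : Subgroup (SL2 F), IsHallPi π H → ∃ g, Q8 a b hab ≤ conjSub g H :=
    fun H hH => hall_sylow Nat.prime_two h2 hQp hH
  have hna : ∀ H : Subgroup (SL2 F), IsHallPi π H → ∃ x ∈ H, ∃ y ∈ H, x * y ≠ y * x := by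
    intro H hH
    obtain ⟨g, hg⟩ := hQ8 H hH
    refine ⟨_, mem_conjSub.1 (hg (I_mem a b hab)), _, mem_conjSub.1 (hg (J_mem a b hab)), ?_⟩
    intro h
    apply IJ_ne a b hab h20
    have := congrArg (fun t => g * t * g⁻¹) h
    convert this using 1 <;> group
  have hz : ∀ H : Subgroup (SL2 F), IsHallPi π H → -1 ∈ H := by
    intro H hH
    obtain ⟨g, hg⟩ := hQ8 H hH
    have := mem_conjSub.1 (hg (neg_mem a b hab))
    simpa using this
  have hD := D_conj h2 h3 h20 h30 hna
  have hT := fun (H : Subgroup (SL2 F)) (hH : IsHallPi π H) (hd : ¬ DT H) =>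
    types h20 (hn0 _ hH.1) (hz H hH) (hna H hH) hd
  have hrefl : ∀ {H H' : Subgroup (SL2 F)}, H = H' → Cj H H' := by
    rintro H _ rfl; exact ⟨1, conjSub_one H⟩
  by_cases hex : ∃ H0 : Subgroup (SL2 F), IsHallPi π H0 ∧ ¬ DT H0
  swap
  · push Not at hex
    exact count2 (fun _ => True) hE h2 (Q8 a b hab) hQp hD
      (fun H H' hH hH' hd => absurd (hex H hH) hd)
  obtain ⟨H0, hH0, hd0⟩ := hex
  rcases hT H0 hH0 hd0 with ⟨hc, -⟩ | ⟨hc, h48, h48'⟩ | ⟨hc, -⟩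
  · refine count2 (fun _ => True) hE h2 (Q8 a b hab) hQp hD ?_
    intro H H' hH hH' hd hd' hQ hQ' _
    have c1 := (hall_card hH hH0).trans hc
    have c2 := (hall_card hH' hH0).trans hc
    have w : ∀ H : Subgroup (SL2 F), IsHallPi π H → ¬ DT H → Q8 a b hab ≤ H → qw a b hab h20 ∈ H := by
      intro H hH hd hQ
      have c1 := (hall_card hH hH0).trans hc
      rcases hT H hH hd with ⟨-, h⟩ | ⟨h, -⟩ | ⟨h, -⟩
      · exact w_mem a b hab h20 hQ _ h
      · omega
      · omega
    exact hrefl (case24 a b hab h20 hQ (w H hH hd hQ) hQ' (w H' hH' hd' hQ') c1 c2)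
  · obtain ⟨-, A, Q, hA, hAQ, hQc, hA8⟩ := sub48 h20 (hz H0 hH0) hc h48 h48'
    obtain ⟨s, hsQ, hsA⟩ : ∃ s ∈ Q, s ∉ A := by
      by_contra hcon
      push Not at hcon
      have := Subgroup.card_le_of_le (show Q ≤ A from hcon)
      omega
    haveI : Fact (Nat.Prime 2) := ⟨Nat.prime_two⟩
    refine count2 (fun H => ∃ E, NE H E ∧ s ∈ E) hE h2 Q
      (IsPGroup.iff_card.2 ⟨4, by rw [hQc]; norm_num⟩) hD ?_
    intro H H' hH hH' hd hd' hQ hQ' hP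
    have c1 := (hall_card hH hH0).trans hc
    have c2 := (hall_card hH' hH0).trans hc
    have e : ∀ H : Subgroup (SL2 F), IsHallPi π H → ¬ DT H → ∃ E, NE H E := by
      intro H hH hd
      have c1 := (hall_card hH hH0).trans hc
      rcases hT H hH hd with ⟨h, -⟩ | ⟨-, h, h'⟩ | ⟨h, -⟩
      · omega
      · exact (sub48 h20 (hz H hH) c1 h h').1
      · omega
    exact hrefl (case48 h20 hA hAQ hQc hA8 hsQ hsA c1 c2 hQ hQ' (e H hH hd) (e H' hH' hd') hP)
  · have h50 : (5 : F) ≠ 0 := by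
      intro h
      apply hn0 _ hH0.1
      rw [hc]
      push_cast
      linear_combination 24 * h
    have ex : ∀ H : Subgroup (SL2 F), IsHallPi π H → ¬ DT H → Q8 a b hab ≤ H → qw a b hab h20 ∈ H ∧
        ∃ x ∈ H, x.1.trace = 0 ∧ (x * qI F).1.trace = 1 ∧ ∃ c : F, c ^ 2 + c - 1 = 0 ∧
      (x * qJ a b hab).1.trace = c ∧ (x * (qI F * qJ a b hab)).1.trace = -1 - c := by
      intro H hH hd hQ
      have c1 := (hall_card hH hH0).trans hc
      rcases hT H hH hd with ⟨h, -⟩ | ⟨h, -⟩ | ⟨-, h1, h4, h5⟩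
      · omega
      · omega
      · have hw := w_mem a b hab h20 hQ _ h4
        refine ⟨hw, exists_x a b hab h20 h30 h50 hQ hw ?_ ?_⟩
        · intro g hg g1 g2
          have hh := h1 ⟨g, hg⟩ (fun h => g1 (congrArg Subtype.val h)) (fun h => g2 (congrArg Subtype.val h))
          have ho := Subgroup.orderOf_dvd_natCard (Subgroup.centralizer {(⟨g, hg⟩ : H)})
            (Subgroup.mem_centralizer_singleton_iff.2 rfl : (⟨g, hg⟩ : H) ∈ _)
          rw [Subgroup.orderOf_mk] at ho
          rcases hh with h | h | h <;> rw [h] at ho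
          · exact Or.inl (orderOf_dvd_iff_pow_eq_one.1 ho)
          · exact Or.inr (Or.inl (orderOf_dvd_iff_pow_eq_one.1 ho))
          · exact Or.inr (Or.inr (orderOf_dvd_iff_pow_eq_one.1 ho))
        · intro g hg g1 g2
          obtain ⟨y, hy⟩ := h5 ⟨g, hg⟩ (fun h => g1 (congrArg Subtype.val h)) (fun h => g2 (congrArg Subtype.val h))
          exact ⟨y.1, y.2, congrArg Subtype.val hy⟩
    by_cases hc0 : ∃ c0 : F, c0 ^ 2 + c0 - 1 = 0
    swap
    · refine count2 (fun _ => True) hE h2 (Q8 a b hab) hQp hD ?_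
      intro H H' hH hH' hd hd' hQ hQ' _
      obtain ⟨-, x, -, -, -, c, hcc, -⟩ := ex H hH hd hQ
      exact absurd ⟨c, hcc⟩ hc0
    obtain ⟨c0, hc0⟩ := hc0
    refine count2 (fun H => ∃ x ∈ H, x.1.trace = 0 ∧ (x * qI F).1.trace = 1 ∧
      (x * qJ a b hab).1.trace = c0 ∧ (x * (qI F * qJ a b hab)).1.trace = -1 - c0) hE h2 (Q8 a b hab) hQp hD ?_
    intro H H' hH hH' hd hd' hQ hQ' hP
    have c1 := (hall_card hH hH0).trans hc
    have c2 := (hall_card hH' hH0).trans hc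
    obtain ⟨w1, x, hx, x0, xI, c, hcr, xJ, xK⟩ := ex H hH hd hQ
    obtain ⟨w2, x', hx', x0', xI', c', hcr', xJ', xK'⟩ := ex H' hH' hd' hQ'
    have hroot : ∀ c : F, c ^ 2 + c - 1 = 0 → c = c0 ∨ c = -1 - c0 := by
      intro c h
      have : (c - c0) * (c + 1 + c0) = 0 := by linear_combination h - hc0
      rcases mul_eq_zero.1 this with h | h
      · left; linear_combination h
      · right; linear_combination h
    by_cases h : ∃ x ∈ H, x.1.trace = 0 ∧ (x * qI F).1.trace = 1 ∧
      (x * qJ a b hab).1.trace = c0 ∧ (x * (qI F * qJ a b hab)).1.trace = -1 - c0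
    · obtain ⟨y', hy', y0', yI', yJ', yK'⟩ := hP.1 h
      obtain ⟨y, hy, y0, yI, yJ, yK⟩ := h
      have e : y = y' := tr_det a b hab h20 y0 y0' (yI.trans yI'.symm) (yJ.trans yJ'.symm) (yK.trans yK'.symm)
      exact hrefl (case120 a b hab h20 h30 hQ w1 hQ' w2 c1 c2 hy (e ▸ hy') y0 yI)
    · have h' := fun k => h (hP.2 k)
      have e1 : c = -1 - c0 := by
        rcases hroot c hcr with k | k
        · exact absurd ⟨x, hx, x0, xI, by rw [xJ, k], by rw [xK, k]⟩ h
        · exact k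
      have e2 : c' = -1 - c0 := by
        rcases hroot c' hcr' with k | k
        · exact absurd ⟨x', hx', x0', xI', by rw [xJ', k], by rw [xK', k]⟩ h'
        · exact k
      have e : x = x' := tr_det a b hab h20 x0 x0' (xI.trans xI'.symm)
        (by rw [xJ, xJ', e1, e2]) (by rw [xK, xK', e1, e2])
      exact hrefl (case120 a b hab h20 h30 hQ w1 hQ' w2 c1 c2 hx (e ▸ hx') x0 xI)

end Fin
end HallSL

/-- Let `F` be a finite field of odd order and characteristic `p`, and let `π`
be a set of primes with `2, 3 ∈ π` and `p ∉ π`. If `SL₂(F)` possesses a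
`π`-Hall subgroup, then the number of conjugacy classes of `π`-Hall subgroups
of `SL₂(F)` belongs to `{1, 2, 3}`. -/
theorem stmt_15 (F : Type*) [Field F] [Fintype F] (hqodd : Odd (Fintype.card F))
    (π : Set ℕ) (h2 : 2 ∈ π) (h3 : 3 ∈ π) (hp : ringChar F ∉ π)
    (hE : ∃ H : Subgroup (Matrix.SpecialLinearGroup (Fin 2) F), IsHallPi π H) :
    kPi π (Matrix.SpecialLinearGroup (Fin 2) F) ∈ ({1, 2, 3} : Set ℕ) := by
  exact HallSL.main π h2 h3 hp hE
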